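/- arXiv:math/0005204 — 2 statements merged into one kernel-verified Lean document; each statement's English description precedes it below -/
import Mathlib

section
/- Let n ≥ 1, p ≥ 0, s ≥ 1 be integers and let f₁,…,f_{p+s} ∈ ℝ[x₁,…,xₙ]. Let S ⊆ ℝⁿ be the set of points x with f_i(x) = 0 for all 1 ≤ i ≤ p and f_{p+i}(x) > 0 for all 1 ≤ i ≤ s. Then the number of connected components of S is at most (n+1)·(2s)ⁿ·V_F. -/
open MeasureTheory

/-- The Newton polytope `Q_F`: convex hull of the origin, the standard basis
vectors, and all exponent vectors of the polynomials `f i`. -/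
noncomputable def QF {n m : ℕ} {R : Type*} [CommSemiring R]
    (f : Fin m → MvPolynomial (Fin n) R) : Set (Fin n → ℝ) :=
  convexHull ℝ ({0} ∪ Set.range (fun j : Fin n => Pi.single j (1 : ℝ)) ∪
    {x | ∃ i d, d ∈ (f i).support ∧ x = fun j => (d j : ℝ)})

/-- `V_F := n! · vol(Q_F)`, the normalized volume of the Newton polytope. -/
noncomputable def VF {n m : ℕ} {R : Type*} [CommSemiring R]
    (f : Fin m → MvPolynomial (Fin n) R) : ℝ :=
  (n.factorial : ℝ) * (volume (QF f)).toReal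

open scoped Pointwise in
/-- The polynomials all of whose exponent vectors lie in the dilate `m • Q`. -/
noncomputable def dilateSupported {n : ℕ} (Q : Set (Fin n → ℝ)) (m : ℕ) :
    Submodule ℝ (MvPolynomial (Fin n) ℝ) :=
  MvPolynomial.restrictSupport ℝ {d | (fun j => (d j : ℝ)) ∈ (m : ℝ) • Q}

section Supports

open MvPolynomial

open scoped Pointwise

variable {n : ℕ} {Q : Set (Fin n → ℝ)}

theorem mem_dilateSupported {m : ℕ} {g : MvPolynomial (Fin n) ℝ} :
    g ∈ dilateSupported Q m ↔ ∀ d ∈ g.support, (fun j => (d j : ℝ)) ∈ (m : ℝ) • Q :=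
  Iff.rfl

theorem dilateSupported_mul (hQ : Convex ℝ Q) {a b : ℕ} {g h : MvPolynomial (Fin n) ℝ}
    (hg : g ∈ dilateSupported Q a) (hh : h ∈ dilateSupported Q b) :
    g * h ∈ dilateSupported Q (a + b) := by
  have := Submodule.mul_mem_mul hg hh
  rw [dilateSupported, dilateSupported, ← restrictSupport_add] at this
  refine restrictSupport_mono ℝ ?_ this
  rintro _ ⟨d, hd, e, he, rfl⟩
  simp only [Set.mem_ofPred_eq] at hd he ⊢
  rw [Nat.cast_add, hQ.add_smul (by positivity) (by positivity)]
  convert! Set.add_mem_add hd he using 1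
  ext j
  simp

theorem dilateSupported_mono (hQ : Convex ℝ Q) (h0 : (0 : Fin n → ℝ) ∈ Q) {a b : ℕ}
    (hab : a ≤ b) : dilateSupported Q a ≤ dilateSupported Q b := by
  refine restrictSupport_mono ℝ fun d hd => ?_
  simp only [Set.mem_ofPred_eq] at hd ⊢
  obtain ⟨c, rfl⟩ := Nat.exists_eq_add_of_le hab
  rw [Nat.cast_add, hQ.add_smul (by positivity) (by positivity)]
  have := Set.add_mem_add hd (Set.smul_mem_smul_set (a := (c : ℝ)) h0)
  simpa using this

theorem C_mem_dilateSupported (h0 : (0 : Fin n → ℝ) ∈ Q) (m : ℕ) (c : ℝ) :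
    (C c : MvPolynomial (Fin n) ℝ) ∈ dilateSupported Q m := by
  rw [dilateSupported, ← monomial_zero', monomial_mem_restrictSupport]
  left
  exact ⟨0, h0, by ext; simp⟩

theorem pow_mem_dilateSupported (hQ : Convex ℝ Q) (h0 : (0 : Fin n → ℝ) ∈ Q) {a : ℕ}
    {g : MvPolynomial (Fin n) ℝ} (hg : g ∈ dilateSupported Q a) (m : ℕ) :
    g ^ m ∈ dilateSupported Q (a * m) := by
  induction m with
  | zero => simpa using C_mem_dilateSupported h0 0 1
  | succ m ih =>
    rw [pow_succ, Nat.mul_succ]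
    exact dilateSupported_mul hQ ih hg

theorem prod_mem_dilateSupported (hQ : Convex ℝ Q) (h0 : (0 : Fin n → ℝ) ∈ Q) {ι : Type*}
    (t : Finset ι) (a : ι → ℕ) (g : ι → MvPolynomial (Fin n) ℝ)
    (hg : ∀ i ∈ t, g i ∈ dilateSupported Q (a i)) :
    ∏ i ∈ t, g i ∈ dilateSupported Q (∑ i ∈ t, a i) := by
  classical
  induction t using Finset.induction_on with
  | empty => simpa using C_mem_dilateSupported h0 0 1
  | insert i t hi ih =>
    rw [Finset.prod_insert hi, Finset.sum_insert hi]
    exact dilateSupported_mul hQ (hg i (Finset.mem_insert_self i t))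
      (ih fun j hj => hg j (Finset.mem_insert_of_mem hj))

theorem exists_mem_dilateSupported (hQ : Convex ℝ Q) (h0 : (0 : Fin n → ℝ) ∈ Q)
    (h1 : ∀ j, Pi.single j (1 : ℝ) ∈ Q) (g : MvPolynomial (Fin n) ℝ) :
    ∃ m, g ∈ dilateSupported Q m := by
  induction g using MvPolynomial.induction_on with
  | C c => exact ⟨0, C_mem_dilateSupported h0 0 c⟩
  | add g h hg hh =>
    obtain ⟨a, ha⟩ := hg
    obtain ⟨b, hb⟩ := hh
    exact ⟨max a b, add_mem (dilateSupported_mono hQ h0 (le_max_left a b) ha)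
      (dilateSupported_mono hQ h0 (le_max_right a b) hb)⟩
  | mul_X g j hg =>
    obtain ⟨a, ha⟩ := hg
    refine ⟨a + 1, dilateSupported_mul hQ ha ?_⟩
    rw [dilateSupported, X, monomial_mem_restrictSupport]
    left
    refine ⟨_, h1 j, ?_⟩
    ext i
    simp [Finsupp.single_apply, Pi.single_apply, eq_comm]

theorem X_mul_pderiv_mem_dilateSupported {m : ℕ} {g : MvPolynomial (Fin n) ℝ}
    (hg : g ∈ dilateSupported Q m) (j : Fin n) :
    X j * pderiv j g ∈ dilateSupported Q m := by
  rw [g.as_sum, map_sum, Finset.mul_sum]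
  refine sum_mem fun d hd => ?_
  rw [X_mul_pderiv_monomial]
  refine Submodule.smul_of_tower_mem _ _ ?_
  rw [dilateSupported, monomial_mem_restrictSupport]
  exact Or.inl (hg hd)

theorem finite_dilateSupported (hQ : Bornology.IsBounded Q) (m : ℕ) :
    Module.Finite ℝ (dilateSupported Q m) := by
  have h2 : ((m : ℝ) • Q ∩ (Submodule.span ℤ (Set.range (Pi.basisFun ℝ (Fin n))) :
    Set (Fin n → ℝ))).Finite := ZSpan.setFinite_inter _ (hQ.smul₀ _)
  have hfin : {d : Fin n →₀ ℕ | (fun j => (d j : ℝ)) ∈ (m : ℝ) • Q}.Finite := by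
    refine Set.Finite.of_finite_image (f := fun d j => (d j : ℝ)) (h2.subset ?_) ?_
    · rintro _ ⟨d, hd, rfl⟩
      refine ⟨hd, ?_⟩
      rw [SetLike.mem_coe, Module.Basis.mem_span_iff_repr_mem]
      exact fun i => ⟨d i, by simp⟩
    · intro d _ e _ hde
      ext j
      exact Nat.cast_injective (congrFun hde j)
  have := hfin.to_subtype
  exact Module.Finite.of_basis (basisRestrictSupport ℝ _)

theorem finrank_dilateSupported_le (hQ : Bornology.IsBounded Q) {m : ℕ} (hm : 0 < m) :
    Module.finrank ℝ (dilateSupported Q m) ≤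
      Nat.card ↑(Q ∩ (m : ℝ)⁻¹ • (Submodule.span ℤ (Set.range (Pi.basisFun ℝ (Fin n))) :
        Set (Fin n → ℝ))) := by
  have hm' : (m : ℝ) ≠ 0 := by positivity
  have : NeZero m := ⟨hm.ne'⟩
  rw [dilateSupported, Module.finrank_eq_nat_card_basis (basisRestrictSupport ℝ _)]
  have hfin : (Q ∩ (m : ℝ)⁻¹ • (Submodule.span ℤ (Set.range (Pi.basisFun ℝ (Fin n))) :
      Set (Fin n → ℝ))).Finite := by
    have h2 : ((m : ℝ) • Q ∩ (Submodule.span ℤ (Set.range (Pi.basisFun ℝ (Fin n))) :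
      Set (Fin n → ℝ))).Finite := ZSpan.setFinite_inter _ (hQ.smul₀ _)
    refine (h2.image fun x => (m : ℝ)⁻¹ • x).subset ?_
    rintro x ⟨hx, hx'⟩
    rw [Set.mem_inv_smul_set_iff₀ hm'] at hx'
    exact ⟨(m : ℝ) • x, ⟨Set.smul_mem_smul_set hx, hx'⟩, inv_smul_smul₀ hm' x⟩
  have := hfin.to_subtype
  refine Nat.card_le_card_of_injective
    (fun d => ⟨(m : ℝ)⁻¹ • (fun j => (d.1 j : ℝ)), ?_, ?_⟩) ?_
  · have := d.2
    simp only [Set.mem_ofPred_eq] at this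
    rwa [Set.mem_smul_set_iff_inv_smul_mem₀ hm'] at this
  · have := BoxIntegral.unitPartition.mem_smul_span_iff (n := m)
      (v := (m : ℝ)⁻¹ • (fun j => (d.1 j : ℝ)))
    refine this.2 fun i => ⟨d.1 i, ?_⟩
    simp [hm']
  · intro d e hde
    have h := smul_right_injective (Fin n → ℝ) (inv_ne_zero hm') (Subtype.ext_iff.1 hde)
    ext j
    exact_mod_cast congrFun h j

theorem natCast_le_of_mul_choose_le_finrank (hQ : Convex ℝ Q) (hQc : IsCompact Q) {N M E : ℕ}
    (hM : 0 < M)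
    (h : ∀ r, N * (n + r).choose n ≤ Module.finrank ℝ (dilateSupported Q (M * r + E))) :
    (N : ℝ) ≤ (M : ℝ) ^ n * (n.factorial * (volume Q).toReal) := by
  have hlim := tendsto_card_div_pow_atTop_volume Q hQc.isBounded hQc.measurableSet
    (hQ.addHaar_frontier _)
  have hsub : Filter.Tendsto (fun r : ℕ => M * r + E) Filter.atTop Filter.atTop :=
    Filter.tendsto_atTop_mono (fun r => (Nat.le_mul_of_pos_left r hM).trans (Nat.le_add_right _ _)) Filter.tendsto_id
  have h1 := hlim.comp hsub
  have hratio : Filter.Tendsto (fun r : ℕ => (r : ℝ) / ((M * r + E : ℕ) : ℝ)) Filter.atTop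
      (nhds ((M : ℝ)⁻¹)) := by
    have h2 : Filter.Tendsto (fun r : ℕ => ((M : ℝ) + E / (r : ℝ))⁻¹) Filter.atTop
        (nhds (((M : ℝ) + 0)⁻¹)) :=
      (tendsto_const_nhds.add (tendsto_const_div_atTop_nhds_zero_nat _)).inv₀ (by positivity)
    rw [add_zero] at h2
    refine h2.congr' ?_
    filter_upwards [Filter.eventually_gt_atTop 0] with r hr
    have : (r : ℝ) ≠ 0 := by positivity
    push_cast
    field_simp
  have h3 : Filter.Tendsto (fun r : ℕ => (N / n.factorial : ℝ) *
      ((r : ℝ) / ((M * r + E : ℕ) : ℝ)) ^ n) Filter.atTop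
      (nhds ((N / n.factorial : ℝ) * ((M : ℝ)⁻¹) ^ n)) := (hratio.pow n).const_mul _
  have h4 := le_of_tendsto_of_tendsto h3 h1 (by
    filter_upwards [Filter.eventually_gt_atTop 0] with r hr
    have hpos : 0 < M * r + E := by positivity
    have hle := (h r).trans (finrank_dilateSupported_le hQc.isBounded hpos)
    have hch := Nat.pow_le_choose (α := ℝ) n (n + r)
    have : n + r + 1 - n = r + 1 := by omega
    rw [this] at hch
    simp only [Function.comp_apply, Fintype.card_fin]
    rw [div_pow, ← mul_div_assoc]
    gcongr
    calc (N / n.factorial : ℝ) * (r : ℝ) ^ n ≤ N * (((r + 1 : ℕ) : ℝ) ^ n / n.factorial) := by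
          rw [div_mul_eq_mul_div, mul_div_assoc]
          gcongr
          linarith
      _ ≤ N * ((n + r).choose n : ℝ) := by gcongr
      _ ≤ _ := by exact_mod_cast hle)
  rw [Measure.real] at h4
  have hM' : (0 : ℝ) < (M : ℝ) ^ n := by positivity
  have hf : (0 : ℝ) < n.factorial := by positivity
  rw [inv_pow, ← div_eq_mul_inv, div_div, div_le_iff₀ (by positivity)] at h4
  linarith

end Supports

section CriticalPoints

open MvPolynomial

variable {n : ℕ}

theorem hasDerivAt_eval_update (g : MvPolynomial (Fin n) ℝ) (x : Fin n → ℝ) (j : Fin n) :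
    HasDerivAt (fun t => eval (Function.update x j t) g) (eval x (pderiv j g)) (x j) := by
  induction g using MvPolynomial.induction_on with
  | C c => simpa using hasDerivAt_const (x j) c
  | add g h hg hh => simpa using hg.fun_add hh
  | mul_X g i hg =>
    have hX : HasDerivAt (fun t => eval (Function.update x j t) (X i : MvPolynomial (Fin n) ℝ))
        (eval x (pderiv j (X i))) (x j) := by
      by_cases hij : i = j
      · subst hij
        simpa using hasDerivAt_id' (x i)
      · simpa [hij, pderiv_X_of_ne (Ne.symm hij), pderiv_X_of_ne hij]
          using hasDerivAt_const (x j) (x i)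
    have := hg.fun_mul hX
    simp only [Function.update_eq_self] at this
    simp only [map_mul, Derivation.leibniz, smul_eq_mul, map_add]
    convert! this using 1
    ring

theorem eval_pderiv_eq_zero_of_isLocalMax {g : MvPolynomial (Fin n) ℝ} {x : Fin n → ℝ}
    (hx : IsLocalMax (fun y => eval y g) x) (j : Fin n) : eval x (pderiv j g) = 0 := by
  have hc : Filter.Tendsto (fun t => Function.update x j t) (nhds (x j)) (nhds x) := by
    have : Continuous fun t : ℝ => Function.update x j t := by fun_prop
    simpa using this.tendsto (x j)
  have hloc : IsLocalMax (fun t => eval (Function.update x j t) g) (x j) := by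
    have := hc.eventually hx
    simpa [IsLocalMax, IsMaxFilter] using this
  exact hloc.hasDerivAt_eq_zero (hasDerivAt_eval_update g x j)

theorem exists_logarithmic_critical_point {g : MvPolynomial (Fin n) ℝ} {T : Set (Fin n → ℝ)}
    (hT : IsCompact T) (hTn : ∀ z ∈ T, 0 < eval z g → T ∈ nhds z) {y : Fin n → ℝ} (hy : y ∈ T)
    (hgy : 0 < eval y g) (k : Fin n → ℕ) :
    ∃ z ∈ T, 0 < eval z g ∧
      ∀ j, z j * eval z (pderiv j g) = -(2 * k j) * eval z g := by
  set e : Fin n →₀ ℕ := Finsupp.equivFunOnFinite.symm fun j => 2 * k j with he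
  have hev : ∀ z, eval z (monomial e (1 : ℝ)) = ∏ j, z j ^ (2 * k j) := fun z => by
    simp [eval_monomial, Finsupp.prod_fintype, he]
  have hev0 : ∀ z, 0 ≤ eval z (monomial e (1 : ℝ)) := fun z => by
    rw [hev]
    exact Finset.prod_nonneg fun j _ => (even_two_mul _).pow_nonneg _
  obtain ⟨y', hy'0, hy'T, hgy'⟩ : ∃ y' : Fin n → ℝ, (∀ j, y' j ≠ 0) ∧ y' ∈ T ∧ 0 < eval y' g := by
    have hd : Dense (Set.pi Set.univ fun _ : Fin n => ({0}ᶜ : Set ℝ)) :=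
      dense_pi _ fun _ _ => dense_compl_singleton 0
    have hn : T ∩ {z | 0 < eval z g} ∈ nhds y :=
      Filter.inter_mem (hTn y hy hgy) ((continuous_eval g).continuousAt.eventually_const_lt hgy)
    obtain ⟨y', h1, h2, h3⟩ := hd.inter_nhds_nonempty hn
    exact ⟨y', fun j => h1 j trivial, h2, h3⟩
  obtain ⟨z, hzT, hz⟩ := hT.exists_isMaxOn ⟨y, hy⟩
    (continuous_eval (g * monomial e (1 : ℝ))).continuousOn
  have hpos : 0 < eval z (g * monomial e (1 : ℝ)) := by
    refine lt_of_lt_of_le ?_ (hz hy'T)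
    simp only [map_mul, hev]
    refine mul_pos hgy' (Finset.prod_pos fun j _ => ?_)
    exact (even_two_mul _).pow_pos (hy'0 j)
  rw [map_mul] at hpos
  have hgz : 0 < eval z g := pos_of_mul_pos_left hpos (hev0 z)
  refine ⟨z, hzT, hgz, fun j => ?_⟩
  have hez : 0 < eval z (monomial e (1 : ℝ)) := pos_of_mul_pos_right hpos hgz.le
  have hcrit := eval_pderiv_eq_zero_of_isLocalMax (hz.isLocalMax (hTn z hzT hgz)) j
  have hX := congrArg (eval z) (X_mul_pderiv_monomial (i := j) (m := e) (r := (1 : ℝ)))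
  simp only [map_mul, eval_X, nsmul_eq_mul, map_natCast] at hX
  have hej : e j = 2 * k j := by simp [he]
  rw [hej] at hX
  push_cast at hX
  simp only [Derivation.leibniz, smul_eq_mul, map_add, map_mul] at hcrit
  have : eval z (monomial e (1 : ℝ)) * (z j * eval z (pderiv j g) + 2 * k j * eval z g) = 0 := by
    linear_combination z j * hcrit - eval z g * hX
  have := (mul_eq_zero.1 this).resolve_left hez.ne'
  linarith

end CriticalPoints

section Independence

open MvPolynomial

variable {n : ℕ} {Q : Set (Fin n → ℝ)}

theorem mul_choose_le_finrank_dilateSupported (hQ : Convex ℝ Q) (hQb : Bornology.IsBounded Q)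
    (h0 : (0 : Fin n → ℝ) ∈ Q) {N M D : ℕ} {g h : MvPolynomial (Fin n) ℝ}
    (hg : g ∈ dilateSupported Q M) (hh : h ∈ dilateSupported Q D)
    (z : (Fin n → ℕ) → Fin N → Fin n → ℝ)
    (hpos : ∀ k i, 0 < eval (z k i) g)
    (hcrit : ∀ k i j, z k i j * eval (z k i) (pderiv j g) = -(2 * k j) * eval (z k i) g)
    (hsep : ∀ k, Function.Injective fun i => eval (z k i) h) (r : ℕ) :
    N * (n + r).choose n ≤ Module.finrank ℝ (dilateSupported Q (M * r + D * N)) := by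
  classical
  let ι := Sym (Option (Fin n)) r
  have hcard : Fintype.card (Fin N × ι) = N * (n + r).choose n := by
    rw [Fintype.card_prod, Fintype.card_fin, Sym.card_sym_eq_choose, Fintype.card_option,
      Fintype.card_fin]
    congr 1
    rw [show n + 1 + r - 1 = n + r by omega]
    exact (Nat.choose_symm_add).symm
  let e : ι → Option (Fin n) → ℕ := fun σ => (Sym.equivNatSumOfFintype _ _ σ).1
  have hesum : ∀ σ, ∑ a, e σ a = r := fun σ => (Sym.equivNatSumOfFintype _ _ σ).2
  have heinj : ∀ σ τ, (∀ j, e σ (some j) = e τ (some j)) → σ = τ := by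
    intro σ τ hστ
    refine (Sym.equivNatSumOfFintype (Option (Fin n)) r).injective (Subtype.ext (funext fun a => ?_))
    have h1 := hesum σ
    have h2 := hesum τ
    rw [Fintype.sum_option] at h1 h2
    have h3 : ∑ j, e σ (some j) = ∑ j, e τ (some j) := Finset.sum_congr rfl fun j _ => hστ j
    cases a with
    | none => change e σ none = e τ none; omega
    | some j => exact hστ j
  let G : Option (Fin n) → MvPolynomial (Fin n) ℝ := fun a => a.elim g fun j => X j * pderiv j g
  have hG : ∀ a, G a ∈ dilateSupported Q M := by
    rintro (_ | j)
    · exact hg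
    · exact X_mul_pderiv_mem_dilateSupported hg j
  have hmem : ∀ x : Fin N × ι, h ^ (x.1 : ℕ) * ∏ a, G a ^ e x.2 a ∈
      dilateSupported Q (M * r + D * N) := by
    intro x
    have h1 := prod_mem_dilateSupported hQ h0 Finset.univ (fun a => M * e x.2 a)
      (fun a => G a ^ e x.2 a) fun a _ => pow_mem_dilateSupported hQ h0 (hG a) _
    rw [← Finset.mul_sum, hesum] at h1
    have h2 := dilateSupported_mul hQ (pow_mem_dilateSupported hQ h0 hh x.1) h1
    refine dilateSupported_mono hQ h0 ?_ h2
    have := Nat.mul_le_mul_left D x.1.2.le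
    omega
  have hind : LinearIndependent ℝ fun x : Fin N × ι =>
      (⟨_, hmem x⟩ : dilateSupported Q (M * r + D * N)) := by
    refine LinearIndependent.of_comp (Submodule.subtype _) ?_
    rw [Fintype.linearIndependent_iff]
    intro c hc
    let d : ι → Fin n →₀ ℕ := fun σ => Finsupp.equivFunOnFinite.symm fun j => e σ (some j)
    have hdinj : Function.Injective d := fun σ τ hστ => heinj σ τ fun j => by
      simpa [d] using DFunLike.congr_fun hστ j
    let R : Fin N → MvPolynomial (Fin n) ℝ := fun m => ∑ σ, monomial (d σ) (c (m, σ))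
    have hR : ∀ m, R m = 0 := by
      intro m
      refine funext_set (fun _ => Set.range fun k : ℕ => -(2 * k : ℝ))
        (fun _ => Set.infinite_range_of_injective fun a b hab => by simpa using hab) ?_
      intro x hx
      choose k hk using fun j => hx j trivial
      have hv : (fun m => eval x (R m)) = 0 := by
        refine Matrix.eq_zero_of_forall_index_sum_pow_mul_eq_zero (hsep k) fun i => ?_
        have hev := congrArg (eval (z k i)) hc
        have hgz := (hpos k i).ne'
        have hprod : ∀ σ, eval (z k i) (∏ a, G a ^ e σ a) =
            eval (z k i) g ^ r * ∏ j, x j ^ e σ (some j) := by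
          intro σ
          rw [map_prod, Fintype.prod_option]
          simp only [G, Option.elim, map_pow, map_mul, eval_X, hcrit]
          simp only [mul_pow, Finset.prod_mul_distrib, Finset.prod_pow_eq_pow_sum]
          have := hesum σ
          rw [Fintype.sum_option] at this
          rw [← this, pow_add]
          simp only [← hk]
          ring
        have hsum : eval (z k i) g ^ r *
            ∑ m : Fin N, eval (z k i) h ^ (m : ℕ) * eval x (R m) = 0 := by
          rw [← map_zero (eval (z k i)), ← hev, map_sum, Fintype.sum_prod_type, Finset.mul_sum]
          refine Finset.sum_congr rfl fun m _ => ?_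
          simp only [R, map_sum, Finset.mul_sum]
          refine Finset.sum_congr rfl fun σ _ => ?_
          simp only [Function.comp_apply, Submodule.subtype_apply, smul_eval, map_mul, map_pow,
            hprod, eval_monomial]
          rw [Finsupp.prod_fintype _ _ (by simp)]
          simp only [d, Finsupp.equivFunOnFinite_symm_apply_apply]
          ring
        exact (mul_eq_zero.1 hsum).resolve_left (pow_ne_zero _ hgz)
      simpa using congrFun hv m
    rintro ⟨m, σ⟩
    have := congrArg (coeff (d σ)) (hR m)
    simp only [R, coeff_sum, coeff_monomial, hdinj.eq_iff, coeff_zero] at this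
    rwa [Fintype.sum_eq_single σ fun τ hτ => if_neg hτ, if_pos rfl] at this
  have := finite_dilateSupported hQb (M * r + D * N)
  rw [← hcard]
  exact hind.fintype_card_le_finrank

end Independence

section Components

open MvPolynomial

variable {n : ℕ}

theorem exists_continuous_int_of_connectedComponents_injective {X : Type*} [TopologicalSpace X]
    [CompactSpace X] [T2Space X] {N : ℕ} (y : Fin N → X)
    (hy : Function.Injective fun i => (y i : ConnectedComponents X)) :
    ∃ c : X → ℤ, Continuous c ∧ ∀ i, c (y i) = (i : ℕ) := by
  classical
  have hex : ∀ i : Fin N, ∃ V : Set (ConnectedComponents X), IsClopen V ∧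
      (y i : ConnectedComponents X) ∈ V ∧ V ⊆ ((fun j => (y j : ConnectedComponents X)) '' {i}ᶜ)ᶜ :=
    fun i => compact_exists_isClopen_in_isOpen (Set.toFinite _).isClosed.isOpen_compl (by
      rintro ⟨j, hj, hji⟩
      exact hj (hy hji))
  choose V hV hyV hVsub using hex
  refine ⟨fun x => ∑ i : Fin N, if (x : ConnectedComponents X) ∈ V i then ((i : ℕ) : ℤ) else 0,
    ?_, fun i => ?_⟩
  · refine continuous_finsetSum _ fun i _ => ?_
    have : Continuous fun z : ConnectedComponents X => if z ∈ V i then ((i : ℕ) : ℤ) else 0 :=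
      continuous_const.if (fun z hz => by
        simp only [Set.ofPred_mem_eq, (hV i).frontier_eq, Set.mem_empty_iff_false] at hz)
        continuous_const
    exact this.comp ConnectedComponents.continuous_coe
  · dsimp only
    rw [Fintype.sum_eq_single i, if_pos (hyV i)]
    intro j hj
    rw [if_neg]
    intro hmem
    exact hVsub j hmem ⟨i, by simpa using hj.symm, rfl⟩

theorem exists_mvPolynomial_near (K : Set (Fin n → ℝ)) (hK : IsCompact K) (c : K → ℝ)
    (hc : Continuous c) {ε : ℝ} (hε : 0 < ε) :
    ∃ h : MvPolynomial (Fin n) ℝ, ∀ x : K, |eval (x : Fin n → ℝ) h - c x| < ε := by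
  have := isCompact_iff_compactSpace.1 hK
  let φ : MvPolynomial (Fin n) ℝ →ₐ[ℝ] C(K, ℝ) :=
    aeval fun j => ⟨fun x : K => (x : Fin n → ℝ) j, (continuous_apply j).comp continuous_subtype_val⟩
  have hφ : ∀ h (x : K), φ h x = eval (x : Fin n → ℝ) h := by
    intro h x
    induction h using MvPolynomial.induction_on with
    | C a => simp [φ]
    | add p q hp hq => simp [hp, hq]
    | mul_X p j hp => simp [hp, φ]
  have hsep : φ.range.SeparatesPoints := by
    intro x y hxy
    obtain ⟨j, hj⟩ := Function.ne_iff.1 (Subtype.coe_ne_coe.2 hxy)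
    exact ⟨_, ⟨φ (X j), ⟨X j, rfl⟩, rfl⟩, by simpa [hφ] using hj⟩
  obtain ⟨⟨_, h, rfl⟩, hh⟩ :=
    ContinuousMap.exists_mem_subalgebra_near_continuous_of_separatesPoints _ hsep c hc ε hε
  exact ⟨h, fun x => by simpa [hφ, Real.norm_eq_abs] using hh x⟩

theorem exists_mvPolynomial_separating {S K : Set (Fin n → ℝ)} (hK : IsCompact K) (hKS : K ⊆ S)
    {N : ℕ} (y : Fin N → S) (hyK : ∀ i, (y i : Fin n → ℝ) ∈ K)
    (hy : Function.Injective fun i => (y i : ConnectedComponents S)) :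
    ∃ h : MvPolynomial (Fin n) ℝ, (∀ x ∈ K, ∃ m : ℤ, |eval x h - m| < 1 / 4) ∧
      ∀ i, |eval (y i : Fin n → ℝ) h - ((i : ℕ) : ℤ)| < 1 / 4 := by
  have := isCompact_iff_compactSpace.1 hK
  have hι : Continuous (Set.inclusion hKS) := continuous_inclusion hKS
  obtain ⟨c, hc, hcy⟩ := exists_continuous_int_of_connectedComponents_injective
    (fun i => (⟨y i, hyK i⟩ : K)) fun i j hij => hy (by
      have := congrArg hι.connectedComponentsMap hij
      simpa only [hι.connectedComponentsMap_mk] using this)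
  obtain ⟨h, hh⟩ := exists_mvPolynomial_near K hK (fun x => (c x : ℝ))
    (continuous_of_discreteTopology.comp hc) (by norm_num : (0 : ℝ) < 1 / 4)
  refine ⟨h, fun x hx => ⟨c ⟨x, hx⟩, hh ⟨x, hx⟩⟩, fun i => ?_⟩
  have := hh ⟨y i, hyK i⟩
  rwa [hcy] at this

theorem int_eq_of_abs_sub_lt {t : ℝ} {a b : ℤ} (ha : |t - a| < 1 / 2) (hb : |t - b| < 1 / 2) :
    a = b := by
  have h : |(a : ℝ) - b| < 1 := by
    rw [abs_lt] at *
    constructor <;> linarith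
  have h' : |a - b| < 1 := by exact_mod_cast h
  rw [Int.abs_lt_one_iff] at h'
  omega

theorem natCast_le_of_connectedComponents_injective {Q : Set (Fin n → ℝ)} (hQ : Convex ℝ Q)
    (hQc : IsCompact Q) (h0 : (0 : Fin n → ℝ) ∈ Q) (h1 : ∀ j, Pi.single j (1 : ℝ) ∈ Q)
    {M s N : ℕ} (hM : 0 < M) {E W : MvPolynomial (Fin n) ℝ} {q : Fin s → MvPolynomial (Fin n) ℝ}
    (hEM : E ∈ dilateSupported Q M) (hWM : W ∈ dilateSupported Q M)
    (hqM : ∏ i, q i ∈ dilateSupported Q M) (hE : ∀ x, 0 ≤ eval x E) (hW : ∀ x, 1 ≤ eval x W)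
    {c : ℝ} (hqW : ∀ x, (eval x (∏ i, q i)) ^ 2 ≤ c * eval x W)
    (hWb : ∀ r, Bornology.IsBounded {x | eval x W ≤ r}) {S : Set (Fin n → ℝ)}
    (hS : S = {x | eval x E = 0 ∧ ∀ i, 0 < eval x (q i)})
    (v : Fin N → ConnectedComponents S) (hv : Function.Injective v) :
    (N : ℝ) ≤ (M : ℝ) ^ n * (n.factorial * (volume Q).toReal) := by
  choose y hy using fun i => ConnectedComponents.surjective_coe (v i)
  have hyinj : Function.Injective fun i => (y i : ConnectedComponents S) := by
    simpa only [hy] using hv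
  have hyE : ∀ i, eval (y i : Fin n → ℝ) E = 0 := fun i => (hS.subset (y i).2).1
  have hyq : ∀ i l, 0 < eval (y i : Fin n → ℝ) (q l) := fun i => (hS.subset (y i).2).2
  have hyB : ∀ i, 0 < eval (y i : Fin n → ℝ) (∏ l, q l) := fun i => by
    rw [map_prod]
    exact Finset.prod_pos fun l _ => hyq i l
  obtain ⟨ε, hεy, hε⟩ : ∃ ε : ℝ, (∀ i, ε * eval (y i : Fin n → ℝ) W <
      eval (y i : Fin n → ℝ) (∏ l, q l)) ∧ 0 < ε := by
    have h : ∀ i, ∀ᶠ ε : ℝ in nhdsWithin 0 (Set.Ioi 0), ε * eval (y i : Fin n → ℝ) W <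
        eval (y i : Fin n → ℝ) (∏ l, q l) := fun i => by
      have hcont : Continuous fun ε : ℝ => ε * eval (y i : Fin n → ℝ) W := by fun_prop
      exact nhdsWithin_le_nhds (hcont.continuousAt.eventually (gt_mem_nhds (by simpa using hyB i)))
    exact ((Filter.eventually_all.2 h).and self_mem_nhdsWithin).exists
  let P : ℕ → MvPolynomial (Fin n) ℝ := fun l => ∏ i, q i - C (l : ℝ) * E - C ε * W
  have hP : ∀ l x, eval x (P l) = eval x (∏ i, q i) - l * eval x E - ε * eval x W := fun l x => by
    simp [P]
  let K : ℕ → Set (Fin n → ℝ) := fun l => {x | 0 ≤ eval x (P l) ∧ ∀ i, 0 ≤ eval x (q i)}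
  have hKclosed : ∀ l, IsClosed (K l) := fun l => by
    have : K l = {x | 0 ≤ eval x (P l)} ∩ ⋂ i, {x | 0 ≤ eval x (q i)} := by
      ext x
      simp [K]
    rw [this]
    exact (isClosed_le continuous_const (continuous_eval _)).inter
      (isClosed_iInter fun i => isClosed_le continuous_const (continuous_eval _))
  have hKB : ∀ l x, 0 ≤ eval x (P l) → ε * eval x W ≤ eval x (∏ i, q i) := fun l x hx => by
    rw [hP] at hx
    have := mul_nonneg (Nat.cast_nonneg (α := ℝ) l) (hE x)
    linarith
  have hKbdd : ∀ l, Bornology.IsBounded (K l) := fun l => by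
    refine (hWb (c / ε ^ 2)).subset fun x hx => ?_
    have h1 := hKB l x hx.1
    have h2 : 0 < eval x W := lt_of_lt_of_le one_pos (hW x)
    have h3 := pow_le_pow_left₀ (by positivity) h1 2
    have h4 := h3.trans (hqW x)
    rw [Set.mem_ofPred_eq, le_div_iff₀ (by positivity)]
    exact le_of_mul_le_mul_right (by linarith) h2
  have hKc : ∀ l, IsCompact (K l) := fun l => Metric.isCompact_of_isClosed_isBounded
    (hKclosed l) (hKbdd l)
  have hqpos : ∀ l x, x ∈ K l → ∀ i, 0 < eval x (q i) := fun l x hx i => by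
    have h1 := hKB l x hx.1
    have h2 : 0 < ε * eval x W := mul_pos hε (lt_of_lt_of_le one_pos (hW x))
    refine lt_of_le_of_ne (hx.2 i) fun h => ?_
    rw [map_prod, Finset.prod_eq_zero (Finset.mem_univ i) h.symm] at h1
    linarith
  have hKanti : Antitone K := fun a b hab x hx => by
    refine ⟨?_, hx.2⟩
    have h1 := hx.1
    rw [hP] at h1 ⊢
    have : (a : ℝ) * eval x E ≤ b * eval x E :=
      mul_le_mul_of_nonneg_right (by exact_mod_cast hab) (hE x)
    linarith
  have hyK : ∀ l i, (y i : Fin n → ℝ) ∈ K l := fun l i => by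
    refine ⟨?_, fun j => (hyq i j).le⟩
    rw [hP, hyE]
    linarith [hεy i]
  have hKS : ⋂ l, K l ⊆ S := by
    intro x hx
    rw [Set.mem_iInter] at hx
    rw [hS]
    refine ⟨?_, hqpos 0 x (hx 0)⟩
    by_contra hne
    have hpos : 0 < eval x E := lt_of_le_of_ne (hE x) (Ne.symm hne)
    obtain ⟨l, hl⟩ := exists_nat_gt (eval x (∏ i, q i) / eval x E)
    rw [div_lt_iff₀ hpos] at hl
    have h1 := (hx l).1
    rw [hP] at h1
    have h2 : 0 < ε * eval x W := mul_pos hε (lt_of_lt_of_le one_pos (hW x))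
    linarith
  obtain ⟨h, hhK, hhy⟩ := exists_mvPolynomial_separating 
    ((hKc 0).of_isClosed_subset (isClosed_iInter hKclosed) (Set.iInter_subset _ 0)) hKS y
    (fun i => Set.mem_iInter.2 fun l => hyK l i) hyinj
  have hOopen : IsOpen {x | ∃ m : ℤ, |eval x h - m| < 1 / 4} := by
    simp only [Set.ofPred_exists]
    exact isOpen_iUnion fun m =>
      isOpen_lt ((continuous_eval h).sub continuous_const).abs continuous_const
  obtain ⟨l, hl⟩ := exists_subset_nhds_of_isCompact hKanti.directed_ge hKc
    fun x hx => hOopen.mem_nhds (hhK x hx)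
  let T : Fin N → Set (Fin n → ℝ) := fun i => K l ∩ {x | |eval x h - ((i : ℕ) : ℤ)| ≤ 1 / 4}
  have hTc : ∀ i, IsCompact (T i) := fun i => (hKc l).inter_right
    (isClosed_le ((continuous_eval h).sub continuous_const).abs continuous_const)
  have hTn : ∀ i, ∀ z ∈ T i, 0 < eval z (P l) → T i ∈ nhds z := by
    intro i z hz hPz
    have h1 : ∀ᶠ x in nhds z, 0 < eval x (P l) :=
      (continuous_eval _).continuousAt.eventually_const_lt hPz
    have h2 : ∀ᶠ x in nhds z, ∀ j, 0 < eval x (q j) := Filter.eventually_all.2 fun j =>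
      (continuous_eval _).continuousAt.eventually_const_lt (hqpos l z hz.1 j)
    have h3 : ∀ᶠ x in nhds z, |eval x h - ((i : ℕ) : ℤ)| < 1 / 2 :=
      ((continuous_eval h).sub continuous_const).abs.continuousAt.eventually
        (gt_mem_nhds (lt_of_le_of_lt hz.2 (by norm_num)))
    filter_upwards [h1, h2, h3] with x hx1 hx2 hx3
    have hxK : x ∈ K l := ⟨hx1.le, fun j => (hx2 j).le⟩
    obtain ⟨m, hm⟩ := hl hxK
    obtain rfl := int_eq_of_abs_sub_lt (hm.trans (by norm_num)) hx3
    exact ⟨hxK, hm.le⟩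
  have hyT : ∀ i, (y i : Fin n → ℝ) ∈ T i := fun i => ⟨hyK l i, (hhy i).le⟩
  have hyP : ∀ i, 0 < eval (y i : Fin n → ℝ) (P l) := fun i => by
    rw [hP, hyE]
    linarith [hεy i]
  choose z hzT hzP hzc using fun (k : Fin n → ℕ) (i : Fin N) =>
    exists_logarithmic_critical_point (hTc i) (hTn i) (hyT i) (hyP i) k
  obtain ⟨D, hD⟩ := exists_mem_dilateSupported hQ h0 h1 h
  have hsmul : ∀ (a : ℝ) {g : MvPolynomial (Fin n) ℝ}, g ∈ dilateSupported Q M →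
      C a * g ∈ dilateSupported Q M := fun a g hg => by
    rw [← smul_eq_C_mul]
    exact Submodule.smul_mem _ _ hg
  refine natCast_le_of_mul_choose_le_finrank hQ hQc hM (E := D * N) fun r =>
    mul_choose_le_finrank_dilateSupported hQ hQc.isBounded h0
      (sub_mem (sub_mem hqM (hsmul _ hEM)) (hsmul _ hWM)) hD z hzP hzc (fun k i j hij => ?_) r
  have hi := (hzT k i).2
  have hj := (hzT k j).2
  simp only [Set.mem_ofPred_eq] at hi hj hij
  rw [← hij] at hj
  have := int_eq_of_abs_sub_lt (hi.trans_lt (by norm_num)) (hj.trans_lt (by norm_num))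
  exact Fin.ext (by exact_mod_cast this)

end Components

section SumOfSquares

open MvPolynomial
open scoped Pointwise

variable {n : ℕ}

/-- The sum of the squares of the monomials with exponents in `A`. -/
noncomputable def sumSqMonomials (A : Finset (Fin n →₀ ℕ)) : MvPolynomial (Fin n) ℝ :=
  ∑ a ∈ A, monomial a 1 ^ 2

theorem eval_sumSqMonomials (A : Finset (Fin n →₀ ℕ)) (x : Fin n → ℝ) :
    eval x (sumSqMonomials A) = ∑ a ∈ A, (eval x (monomial a 1)) ^ 2 := by
  simp [sumSqMonomials]

theorem sq_eval_monomial_le {A : Finset (Fin n →₀ ℕ)} {a : Fin n →₀ ℕ} (ha : a ∈ A)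
    (x : Fin n → ℝ) : (eval x (monomial a 1)) ^ 2 ≤ eval x (sumSqMonomials A) := by
  rw [eval_sumSqMonomials]
  exact Finset.single_le_sum (f := fun a => (eval x (monomial a (1 : ℝ))) ^ 2)
    (fun _ _ => sq_nonneg _) ha

theorem sq_eval_le {A : Finset (Fin n →₀ ℕ)} {g : MvPolynomial (Fin n) ℝ} (hg : g.support ⊆ A)
    (x : Fin n → ℝ) :
    (eval x g) ^ 2 ≤ (∑ a ∈ A, coeff a g ^ 2) * eval x (sumSqMonomials A) := by
  have h : eval x g = ∑ a ∈ A, coeff a g * eval x (monomial a 1) := by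
    conv_lhs => rw [g.as_sum, map_sum]
    rw [Finset.sum_subset hg fun a _ ha => by rw [notMem_support_iff.1 ha]; simp]
    simp [eval_monomial]
  rw [h, eval_sumSqMonomials]
  exact Finset.sum_mul_sq_le_sq_mul_sq _ _ _

theorem one_le_eval_sumSqMonomials {A : Finset (Fin n →₀ ℕ)} (h0 : 0 ∈ A) (x : Fin n → ℝ) :
    1 ≤ eval x (sumSqMonomials A) := by
  simpa using sq_eval_monomial_le h0 x

theorem isBounded_eval_sumSqMonomials_pow_le {A : Finset (Fin n →₀ ℕ)} (h0 : 0 ∈ A)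
    (h1 : ∀ j, Finsupp.single j 1 ∈ A) {s : ℕ} (hs : s ≠ 0) (r : ℝ) :
    Bornology.IsBounded {x | eval x (sumSqMonomials A ^ s) ≤ r} := by
  refine (Metric.isBounded_Icc (fun _ : Fin n => -max r 1) (fun _ => max r 1)).subset ?_
  intro x hx
  rw [Set.mem_ofPred_eq, map_pow] at hx
  have hxj : ∀ j, |x j| ≤ max r 1 := fun j => by
    have h2 := sq_eval_monomial_le (h1 j) x
    have h3 := le_self_pow₀ (one_le_eval_sumSqMonomials h0 x) hs
    have h4 : x j ^ 2 ≤ r := by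
      have : eval x (monomial (Finsupp.single j 1) (1 : ℝ)) = x j := by simp [eval_monomial]
      rw [this] at h2
      linarith
    refine abs_le_of_sq_le_sq (h4.trans ?_) (by positivity)
    nlinarith [le_max_left r 1, le_max_right r 1]
  exact ⟨fun j => (abs_le.1 (hxj j)).1, fun j => (abs_le.1 (hxj j)).2⟩

theorem sumSqMonomials_mem_dilateSupported {Q : Set (Fin n → ℝ)} (hQ : Convex ℝ Q)
    (h0 : (0 : Fin n → ℝ) ∈ Q) {A : Finset (Fin n →₀ ℕ)}
    (hA : ∀ a ∈ A, (fun j => (a j : ℝ)) ∈ Q) : sumSqMonomials A ∈ dilateSupported Q 2 := by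
  refine sum_mem fun a ha => ?_
  have h := pow_mem_dilateSupported hQ h0 (a := 1) (g := monomial a 1) ?_ 2
  · simpa using h
  · rw [dilateSupported, monomial_mem_restrictSupport]
    left
    rw [Set.mem_ofPred_eq, Nat.cast_one, one_smul]
    exact hA a ha

end SumOfSquares

section NewtonPolytope

open scoped Pointwise

variable {n m : ℕ}

theorem convex_QF (f : Fin m → MvPolynomial (Fin n) ℝ) : Convex ℝ (QF f) :=
  convex_convexHull ℝ _

theorem exponent_mem_QF (f : Fin m → MvPolynomial (Fin n) ℝ) {i : Fin m} {d : Fin n →₀ ℕ}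
    (hd : d ∈ (f i).support) : (fun j => (d j : ℝ)) ∈ QF f :=
  subset_convexHull ℝ _ (Or.inr ⟨i, d, hd, rfl⟩)

theorem zero_mem_QF (f : Fin m → MvPolynomial (Fin n) ℝ) : (0 : Fin n → ℝ) ∈ QF f :=
  subset_convexHull ℝ _ (Or.inl (Or.inl rfl))

theorem single_mem_QF (f : Fin m → MvPolynomial (Fin n) ℝ) (j : Fin n) :
    Pi.single j (1 : ℝ) ∈ QF f :=
  subset_convexHull ℝ _ (Or.inl (Or.inr ⟨j, rfl⟩))

theorem isCompact_QF (f : Fin m → MvPolynomial (Fin n) ℝ) : IsCompact (QF f) := by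
  refine Set.Finite.isCompact_convexHull ℝ (((Set.finite_singleton _).union
    (Set.finite_range _)).union ?_)
  refine (Set.finite_iUnion fun i : Fin m => ((f i).support.finite_toSet.image
    fun d j => (d j : ℝ))).subset ?_
  rintro _ ⟨i, d, hd, rfl⟩
  exact Set.mem_iUnion.2 ⟨i, d, hd, rfl⟩

theorem mem_dilateSupported_QF (f : Fin m → MvPolynomial (Fin n) ℝ) (i : Fin m) :
    f i ∈ dilateSupported (QF f) 1 :=
  mem_dilateSupported.2 fun d hd => by
    rw [Nat.cast_one, one_smul]
    exact exponent_mem_QF f hd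

end NewtonPolytope

open MvPolynomial in
theorem natCast_le_two_mul_pow_mul_VF {n p s N : ℕ} (hs : s ≠ 0)
    (f : Fin (p + s) → MvPolynomial (Fin n) ℝ) {S : Set (Fin n → ℝ)}
    (hS : S = {x | (∀ i : Fin (p + s), (i : ℕ) < p → eval x (f i) = 0) ∧
      (∀ i : Fin (p + s), p ≤ (i : ℕ) → 0 < eval x (f i))})
    (v : Fin N → ConnectedComponents S) (hv : Function.Injective v) :
    (N : ℝ) ≤ (2 * s : ℝ) ^ n * VF f := by
  classical
  have hQ := convex_QF f
  have h0 := zero_mem_QF f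
  let A : Finset (Fin n →₀ ℕ) := insert 0 (Finset.univ.image fun j => Finsupp.single j 1) ∪
    Finset.univ.biUnion fun i => (f i).support
  have hA0 : 0 ∈ A := by simp [A]
  have hA1 : ∀ j, Finsupp.single j 1 ∈ A := fun j => by simp [A]
  have hAf : ∀ i, (f i).support ⊆ A := fun i =>
    (Finset.subset_biUnion_of_mem (fun i => (f i).support) (Finset.mem_univ i)).trans
      Finset.subset_union_right
  have hAQ : ∀ a ∈ A, (fun j => (a j : ℝ)) ∈ QF f := by
    intro a ha
    simp only [A, Finset.mem_union, Finset.mem_insert, Finset.mem_image, Finset.mem_biUnion,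
      Finset.mem_univ, true_and] at ha
    rcases ha with (rfl | ⟨j, rfl⟩) | ⟨i, hi⟩
    · convert! h0 using 1
      ext i
      simp
    · convert! single_mem_QF f j using 1
      ext i
      simp [Finsupp.single_apply, Pi.single_apply, eq_comm]
    · exact exponent_mem_QF f hi
  let E : MvPolynomial (Fin n) ℝ := ∑ i : Fin p, f (Fin.castAdd s i) ^ 2
  let q : Fin s → MvPolynomial (Fin n) ℝ := fun i => f (Fin.natAdd p i)
  have hEev : ∀ x, eval x E = ∑ i : Fin p, eval x (f (Fin.castAdd s i)) ^ 2 := fun x => by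
    simp [E]
  have hSE : S = {x | eval x E = 0 ∧ ∀ i, 0 < eval x (q i)} := by
    rw [hS]
    ext x
    simp only [Set.mem_ofPred_eq, hEev, Finset.sum_eq_zero_iff_of_nonneg fun i _ =>
      sq_nonneg (eval x (f (Fin.castAdd s i))), Finset.mem_univ, true_imp_iff, sq_eq_zero_iff,
      Fin.forall_fin_add, q]
    simp
  have hEM : E ∈ dilateSupported (QF f) (2 * s) := by
    refine sum_mem fun i _ => ?_
    have := pow_mem_dilateSupported hQ h0 (mem_dilateSupported_QF f (Fin.castAdd s i)) 2
    exact dilateSupported_mono hQ h0 (by omega) this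
  have hqM : ∏ i, q i ∈ dilateSupported (QF f) (2 * s) := by
    have := prod_mem_dilateSupported hQ h0 Finset.univ (fun _ => 1) q
      fun i _ => mem_dilateSupported_QF f (Fin.natAdd p i)
    refine dilateSupported_mono hQ h0 ?_ this
    simp
    omega
  have hWM := pow_mem_dilateSupported hQ h0 (sumSqMonomials_mem_dilateSupported hQ h0 hAQ) s
  have hqW : ∀ x, (eval x (∏ i, q i)) ^ 2 ≤
      (∏ i, ∑ a ∈ A, coeff a (q i) ^ 2) * eval x (sumSqMonomials A ^ s) := fun x => by
    have h := Finset.prod_le_prod (s := Finset.univ) (fun i _ => sq_nonneg (eval x (q i)))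
      fun i _ => sq_eval_le (hAf (Fin.natAdd p i)) x
    rw [Finset.prod_mul_distrib, Finset.prod_pow] at h
    simpa [map_prod] using h
  have := natCast_le_of_connectedComponents_injective hQ (isCompact_QF f) h0 (single_mem_QF f)
    (by omega) hEM hWM hqM
    (fun x => by rw [hEev]; exact Finset.sum_nonneg fun i _ => sq_nonneg _)
    (fun x => by rw [map_pow]; exact one_le_pow₀ (one_le_eval_sumSqMonomials hA0 x))
    hqW (isBounded_eval_sumSqMonomials_pow_le hA0 hA1 hs) hSE v hv
  simpa [VF] using this

theorem stmt0 (n p s : ℕ) (hn : 1 ≤ n) (hs : 1 ≤ s)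
    (f : Fin (p + s) → MvPolynomial (Fin n) ℝ)
    (S : Set (Fin n → ℝ))
    (hS : S = {x | (∀ i : Fin (p + s), (i : ℕ) < p → MvPolynomial.eval x (f i) = 0) ∧
      (∀ i : Fin (p + s), p ≤ (i : ℕ) → 0 < MvPolynomial.eval x (f i))}) :
    Finite (ConnectedComponents ↥S) ∧
      (Nat.card (ConnectedComponents ↥S) : ℝ) ≤ (n + 1) * (2 * s) ^ n * VF f := by
  have hbound : ∀ (N : ℕ) (v : Fin N → ConnectedComponents S), Function.Injective v →
      (N : ℝ) ≤ (2 * s : ℝ) ^ n * VF f := fun N v hv =>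
    natCast_le_two_mul_pow_mul_VF (by omega) f hS v hv
  have hfin : Finite (ConnectedComponents S) := by
    by_contra hinf
    rw [not_finite_iff_infinite] at hinf
    obtain ⟨N, hN⟩ := exists_nat_gt ((2 * s : ℝ) ^ n * VF f)
    exact absurd (hbound N _ ((Infinite.natEmbedding _).injective.comp Fin.val_injective))
      (not_le.2 hN)
  refine ⟨hfin, (hbound _ _ (Finite.equivFin (ConnectedComponents S)).symm.injective).trans ?_⟩
  have hVF : 0 ≤ VF f := mul_nonneg (Nat.cast_nonneg _) ENNReal.toReal_nonneg
  rw [mul_assoc]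
  refine le_mul_of_one_le_left (by positivity) ?_
  linarith [Nat.cast_nonneg (α := ℝ) n]
end

section
/- Let n ≥ 1, p ≥ 0, s ≥ 2 be integers and let f₁,…,f_{p+s} ∈ ℝ[x₁,…,xₙ]. Let S ⊆ ℝⁿ be the set of points x with f_i(x) = 0 for all 1 ≤ i ≤ p and f_{p+i}(x) > 0 for all 1 ≤ i ≤ s. Then the number of connected components of S is at most ((s+1)/(s−1))·(2s)ⁿ·V_F. -/
open MeasureTheory

open MvPolynomial Pointwise Topology Filter Set

section Lattice

variable {n : ℕ}

/-- The exponents lying in the dilate `m • Q`. -/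
def dilateExponents (Q : Set (Fin n → ℝ)) (m : ℕ) : Set (Fin n →₀ ℕ) :=
  {d | (fun j => (d j : ℝ)) ∈ (m : ℝ) • Q}

/-- Polynomials all of whose exponents lie in the dilate `m • Q`. -/
noncomputable abbrev dilatePoly (Q : Set (Fin n → ℝ)) (m : ℕ) :
    Submodule ℝ (MvPolynomial (Fin n) ℝ) :=
  restrictSupport ℝ (dilateExponents Q m)

variable {Q : Set (Fin n → ℝ)}

theorem dilateExponents_add (hQ : Convex ℝ Q) {a b : ℕ} {d e : Fin n →₀ ℕ}
    (hd : d ∈ dilateExponents Q a) (he : e ∈ dilateExponents Q b) :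
    d + e ∈ dilateExponents Q (a + b) := by
  simp only [dilateExponents, mem_ofPred_eq] at *
  push_cast
  rw [hQ.add_smul (Nat.cast_nonneg a) (Nat.cast_nonneg b)]
  convert Set.add_mem_add hd he using 1
  ext j
  simp

theorem zero_mem_dilateExponents (h0 : (0 : Fin n → ℝ) ∈ Q) (m : ℕ) :
    (0 : Fin n →₀ ℕ) ∈ dilateExponents Q m :=
  ⟨0, h0, by ext; simp⟩

theorem dilatePoly_mul_mem (hQ : Convex ℝ Q) {a b : ℕ} {p q : MvPolynomial (Fin n) ℝ}
    (hp : p ∈ dilatePoly Q a) (hq : q ∈ dilatePoly Q b) : p * q ∈ dilatePoly Q (a + b) := by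
  refine restrictSupport_mono ℝ (s := dilateExponents Q a + dilateExponents Q b) ?_ ?_
  · rw [Set.add_subset_iff]
    exact fun d hd e he => dilateExponents_add hQ hd he
  · rw [restrictSupport_add]
    exact Submodule.mul_mem_mul hp hq

theorem dilatePoly_C_mem (h0 : (0 : Fin n → ℝ) ∈ Q) (m : ℕ) (r : ℝ) :
    (C r : MvPolynomial (Fin n) ℝ) ∈ dilatePoly Q m :=
  (monomial_mem_restrictSupport ℝ).2 (Or.inl (zero_mem_dilateExponents h0 m))

theorem dilatePoly_one_mem (h0 : (0 : Fin n → ℝ) ∈ Q) (m : ℕ) :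
    (1 : MvPolynomial (Fin n) ℝ) ∈ dilatePoly Q m := by
  simpa using dilatePoly_C_mem h0 m 1

theorem dilatePoly_mono (hQ : Convex ℝ Q) (h0 : (0 : Fin n → ℝ) ∈ Q) {a b : ℕ} (hab : a ≤ b) :
    dilatePoly Q a ≤ dilatePoly Q b := by
  intro p hp
  obtain ⟨c, rfl⟩ := Nat.exists_eq_add_of_le hab
  simpa using dilatePoly_mul_mem hQ hp (dilatePoly_one_mem h0 c)

theorem dilatePoly_prod_mem (hQ : Convex ℝ Q) (h0 : (0 : Fin n → ℝ) ∈ Q) {ι : Type*}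
    (s : Finset ι) (c : ι → ℕ) (p : ι → MvPolynomial (Fin n) ℝ)
    (hp : ∀ i ∈ s, p i ∈ dilatePoly Q (c i)) :
    ∏ i ∈ s, p i ∈ dilatePoly Q (∑ i ∈ s, c i) := by
  classical
  induction s using Finset.induction_on with
  | empty => simpa using dilatePoly_one_mem h0 0
  | insert i s hi ih =>
    rw [Finset.prod_insert hi, Finset.sum_insert hi]
    exact dilatePoly_mul_mem hQ (hp i (by simp)) (ih fun j hj => hp j (by simp [hj]))

theorem dilatePoly_pow_mem (hQ : Convex ℝ Q) (h0 : (0 : Fin n → ℝ) ∈ Q) {a : ℕ}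
    {p : MvPolynomial (Fin n) ℝ} (hp : p ∈ dilatePoly Q a) (k : ℕ) :
    p ^ k ∈ dilatePoly Q (k * a) := by
  simpa using dilatePoly_prod_mem hQ h0 (Finset.range k) (fun _ => a) (fun _ => p) fun _ _ => hp

theorem dilatePoly_X_mem (he : ∀ j, Pi.single j (1 : ℝ) ∈ Q) (j : Fin n) :
    (X j : MvPolynomial (Fin n) ℝ) ∈ dilatePoly Q 1 := by
  refine (monomial_mem_restrictSupport ℝ).2 (Or.inl ?_)
  refine ⟨_, he j, ?_⟩
  ext i
  by_cases h : i = j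
  · subst h; simp
  · simp [h]

theorem exists_mem_dilatePoly (hQ : Convex ℝ Q) (h0 : (0 : Fin n → ℝ) ∈ Q)
    (he : ∀ j, Pi.single j (1 : ℝ) ∈ Q) (p : MvPolynomial (Fin n) ℝ) :
    ∃ c, p ∈ dilatePoly Q c := by
  induction p using MvPolynomial.induction_on with
  | C a => exact ⟨0, dilatePoly_C_mem h0 0 a⟩
  | add p q hp hq =>
    obtain ⟨a, ha⟩ := hp
    obtain ⟨b, hb⟩ := hq
    exact ⟨a + b, add_mem (dilatePoly_mono hQ h0 (Nat.le_add_right a b) ha)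
      (dilatePoly_mono hQ h0 (Nat.le_add_left b a) hb)⟩
  | mul_X p j hp =>
    obtain ⟨a, ha⟩ := hp
    exact ⟨a + 1, dilatePoly_mul_mem hQ ha (dilatePoly_X_mem he j)⟩

theorem X_mul_pderiv_mem_restrictSupport {s : Set (Fin n →₀ ℕ)} {p : MvPolynomial (Fin n) ℝ}
    (hp : p ∈ restrictSupport ℝ s) (i : Fin n) : X i * pderiv i p ∈ restrictSupport ℝ s := by
  rw [p.as_sum, map_sum, Finset.mul_sum]
  refine Submodule.sum_mem _ fun d hd => ?_
  rw [X_mul_pderiv_monomial]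
  exact Submodule.smul_of_tower_mem _ _
    ((monomial_mem_restrictSupport ℝ).2 (Or.inl ((mem_restrictSupport_iff ℝ).1 hp hd)))

theorem injOn_dilateExponents_scaling {m : ℕ} (hm : 0 < m) :
    InjOn (fun d : Fin n →₀ ℕ => ((m : ℝ)⁻¹ • fun j => (d j : ℝ) : Fin n → ℝ))
      (dilateExponents Q m) := by
  intro d _ e _ h
  have hm' : (m : ℝ)⁻¹ ≠ 0 := by positivity
  have := smul_right_injective (Fin n → ℝ) hm' h
  ext j
  exact_mod_cast congrFun this j

theorem mapsTo_dilateExponents_scaling {m : ℕ} (hm : 0 < m) :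
    MapsTo (fun d : Fin n →₀ ℕ => ((m : ℝ)⁻¹ • fun j => (d j : ℝ) : Fin n → ℝ))
      (dilateExponents Q m) (Q ∩ (m : ℝ)⁻¹ •
        (Submodule.span ℤ (Set.range (Pi.basisFun ℝ (Fin n))) : Set (Fin n → ℝ))) := by
  intro d hd
  refine ⟨?_, Set.smul_mem_smul_set ?_⟩
  · exact (Set.mem_smul_set_iff_inv_smul_mem₀ (by positivity) _ _).1 hd
  · rw [SetLike.mem_coe, Module.Basis.mem_span_iff_repr_mem]
    exact fun j => ⟨d j, by simp⟩

theorem finite_inter_scaled_lattice (hb : Bornology.IsBounded Q) {m : ℕ} (hm : 0 < m) :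
    (Q ∩ (m : ℝ)⁻¹ • (Submodule.span ℤ (Set.range (Pi.basisFun ℝ (Fin n))) :
      Set (Fin n → ℝ))).Finite := by
  have hm' : (m : ℝ) ≠ 0 := by positivity
  have h := ZSpan.setFinite_inter (Pi.basisFun ℝ (Fin n)) (hb.smul₀ (m : ℝ))
  refine Set.Finite.subset (h.smul_set (a := (m : ℝ)⁻¹)) ?_
  rintro x ⟨hx, hx'⟩
  refine (Set.mem_smul_set_iff_inv_smul_mem₀ (by positivity) _ _).2 ⟨?_, ?_⟩
  · simpa using Set.smul_mem_smul_set hx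
  · exact (Set.mem_smul_set_iff_inv_smul_mem₀ (by positivity) _ _).1 hx'

theorem finite_dilateExponents (hb : Bornology.IsBounded Q) {m : ℕ} (hm : 0 < m) :
    (dilateExponents Q m).Finite :=
  Set.Finite.of_injOn (mapsTo_dilateExponents_scaling hm) (injOn_dilateExponents_scaling hm)
    (finite_inter_scaled_lattice hb hm)

theorem ncard_dilateExponents_le (hb : Bornology.IsBounded Q) {m : ℕ} (hm : 0 < m) :
    (dilateExponents Q m).ncard ≤ Nat.card ↑(Q ∩ (m : ℝ)⁻¹ •
      (Submodule.span ℤ (Set.range (Pi.basisFun ℝ (Fin n))) : Set (Fin n → ℝ))) :=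
  Set.ncard_le_ncard_of_injOn _ (mapsTo_dilateExponents_scaling hm)
    (injOn_dilateExponents_scaling hm) (finite_inter_scaled_lattice hb hm)

theorem finrank_dilatePoly (Q : Set (Fin n → ℝ)) (m : ℕ) :
    Module.finrank ℝ (dilatePoly Q m) = (dilateExponents Q m).ncard :=
  Module.finrank_eq_nat_card_basis (basisRestrictSupport ℝ (dilateExponents Q m))

theorem finiteDimensional_dilatePoly (hb : Bornology.IsBounded Q) {m : ℕ} (hm : 0 < m) :
    FiniteDimensional ℝ (dilatePoly Q m) :=
  have := (finite_dilateExponents hb hm).to_subtype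
  Module.Finite.of_basis (basisRestrictSupport ℝ (dilateExponents Q m))

end Lattice

section Independence

variable {n : ℕ}

theorem MvPolynomial.hasFDerivAt_eval (p : MvPolynomial (Fin n) ℝ) (x : Fin n → ℝ) :
    HasFDerivAt (fun x => eval x p)
      (∑ i, eval x (pderiv i p) • (ContinuousLinearMap.proj i : (Fin n → ℝ) →L[ℝ] ℝ)) x := by
  induction p using MvPolynomial.induction_on with
  | C a => simpa using hasFDerivAt_const (𝕜 := ℝ) a x
  | add p q hp hq =>
    simp only [map_add, add_smul, Finset.sum_add_distrib]
    exact hp.add hq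
  | mul_X p j hp =>
    have h := hp.mul (ContinuousLinearMap.proj j : (Fin n → ℝ) →L[ℝ] ℝ).hasFDerivAt
    simp only [ContinuousLinearMap.proj_apply] at h
    simp only [map_mul, eval_X]
    refine h.congr_fderiv ?_
    ext v
    simp [Derivation.leibniz, pderiv_X, Pi.single_apply, add_smul, Finset.sum_add_distrib,
      Finset.mul_sum, apply_ite, mul_comm, mul_left_comm]

theorem MvPolynomial.tendsto_eval_line_div (p : MvPolynomial (Fin n) ℝ) {x : Fin n → ℝ}
    (hx : eval x p = 0) (v : Fin n → ℝ) :
    Tendsto (fun t : ℝ => eval (x + t • v) p / t) (𝓝[≠] 0)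
      (𝓝 (∑ j, eval x (pderiv j p) * v j)) := by
  have hl : HasDerivAt (fun t : ℝ => x + t • v) v 0 := by
    simpa using ((hasDerivAt_id (0 : ℝ)).smul_const v).const_add x
  have h := HasFDerivAt.comp_hasDerivAt (x := (0 : ℝ)) (f := fun t : ℝ => x + t • v)
    (l := fun x => eval x p) (by simpa using hasFDerivAt_eval p (x + (0 : ℝ) • v)) hl
  have h' := hasDerivAt_iff_tendsto_slope.1 h
  simp only [FunLike.coe_sum, Finset.sum_apply, FunLike.coe_smul, Pi.smul_apply,
    ContinuousLinearMap.proj_apply, smul_eq_mul] at h'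
  refine h'.congr fun t => ?_
  simp [slope_def_field, hx]

theorem linearIndependent_of_simple_zeros {ι : Type*} [DecidableEq ι] (z : ι → Fin n → ℝ)
    (h g : _ → MvPolynomial (Fin n) ℝ) (hz : ∀ k (i : Fin n), eval (z k) (h i) = 0)
    (hdet : ∀ k, (Matrix.of fun i j => eval (z k) (pderiv j (h i))).det ≠ 0)
    (hg : ∀ k l, eval (z k) (g l) = if k = l then 1 else 0) :
    LinearIndependent ℝ (fun a : (Fin n →₀ ℕ) × ι => (∏ i, h i ^ a.1 i) * g a.2) := by
  rw [linearIndependent_iff]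
  intro l hl
  suffices H : ∀ d : ℕ, ∀ a, a.1.degree = d → l a = 0 by
    ext a; exact H _ a rfl
  intro d
  induction d using Nat.strong_induction_on with
  | _ d ih =>
  rintro ⟨e, k⟩ hd
  simp only at hd
  have hdeg : ∀ a ∈ l.support, d ≤ a.1.degree := by
    intro a ha
    by_contra! hlt
    exact (Finsupp.mem_support_iff.1 ha) (ih _ hlt a rfl)
  let q : MvPolynomial (Fin n) ℝ := ∑ a ∈ l.support,
    monomial a.1 (l a * 0 ^ (a.1.degree - d) * if k = a.2 then 1 else 0)
  have hq : q = 0 := by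
    refine MvPolynomial.funext fun w => ?_
    obtain ⟨v, hv⟩ := Matrix.mulVec_surjective_iff_isUnit.2
      ((Matrix.isUnit_iff_isUnit_det _).2 (isUnit_iff_ne_zero.2 (hdet k))) w
    have hlim : Tendsto (fun t : ℝ => ∑ a ∈ l.support,
        l a * (∏ i, (eval (z k + t • v) (h i) / t) ^ a.1 i) * t ^ (a.1.degree - d) *
          eval (z k + t • v) (g a.2)) (𝓝[≠] 0)
        (𝓝 (∑ a ∈ l.support, l a * (∏ i, w i ^ a.1 i) * 0 ^ (a.1.degree - d) *
          if k = a.2 then 1 else 0)) := by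
      refine tendsto_finsetSum _ fun a _ => ?_
      refine ((tendsto_const_nhds.mul (tendsto_finsetProd _ fun i _ => ?_)).mul ?_).mul ?_
      · have := (tendsto_eval_line_div (h i) (hz k i) v).pow (a.1 i)
        rw [← hv]
        simpa [Matrix.mulVec, dotProduct] using this
      · exact ((continuous_pow _).tendsto (0 : ℝ)).mono_left nhdsWithin_le_nhds
      · have hc : Continuous fun t : ℝ => eval (z k + t • v) (g a.2) :=
          (MvPolynomial.continuous_eval _).comp (by fun_prop)
        have := hc.tendsto 0
        simp only [zero_smul, add_zero, hg] at this
        exact this.mono_left nhdsWithin_le_nhds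
    have hzero : Tendsto (fun _ : ℝ => (0 : ℝ)) (𝓝[≠] 0) (𝓝 0) := tendsto_const_nhds
    have huniq := tendsto_nhds_unique (hlim.congr' ?_) hzero
    · simp only [q, map_sum, eval_monomial, map_zero]
      refine Eq.trans ?_ huniq
      refine Finset.sum_congr rfl fun a _ => ?_
      rw [Finsupp.prod_fintype _ _ (by simp)]
      ring
    · filter_upwards [self_mem_nhdsWithin] with t ht
      have ht : t ≠ 0 := ht
      have hev := congrArg (eval (z k + t • v)) hl
      simp only [Finsupp.linearCombination_apply, Finsupp.sum, map_sum, smul_eval, map_mul,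
        map_prod, map_pow, map_zero] at hev
      rw [← mul_right_inj' (pow_ne_zero d ht), mul_zero, ← hev, Finset.mul_sum]
      refine Finset.sum_congr rfl fun a ha => ?_
      simp only [div_pow, Finset.prod_div_distrib]
      rw [Finset.prod_pow_eq_pow_sum, ← Finsupp.degree_eq_sum]
      have : t ^ a.1.degree = t ^ d * t ^ (a.1.degree - d) := by
        rw [← pow_add, Nat.add_sub_cancel' (hdeg a ha)]
      rw [this]
      field_simp
  by_contra hne
  have hmem : (e, k) ∈ l.support := Finsupp.mem_support_iff.2 hne
  have hc := congrArg (coeff e) hq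
  simp only [q, coeff_sum, coeff_monomial, coeff_zero] at hc
  rw [Finset.sum_eq_single (e, k)] at hc
  · simp [hd] at hc
    exact hne hc
  · rintro ⟨e', k'⟩ _ hne'
    by_cases h1 : e' = e
    · subst h1
      have : k ≠ k' := fun h => hne' (by rw [h])
      simp [this]
    · simp [h1]
  · exact fun h => (h hmem).elim

theorem exists_interpolation {ι : Type*} [Fintype ι] [DecidableEq ι] {z : ι → Fin n → ℝ}
    (hz : Function.Injective z) (l : ι) :
    ∃ g : MvPolynomial (Fin n) ℝ, ∀ k, eval (z k) g = if k = l then 1 else 0 := by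
  have H : ∀ k, ∃ g : MvPolynomial (Fin n) ℝ, k ≠ l → eval (z k) g = 0 ∧ eval (z l) g = 1 := by
    intro k
    by_cases hk : k = l
    · exact ⟨0, fun h => (h hk).elim⟩
    · obtain ⟨j, hj⟩ := Function.ne_iff.1 (hz.ne hk)
      refine ⟨C (z l j - z k j)⁻¹ * (X j - C (z k j)), fun _ => ⟨by simp, ?_⟩⟩
      simpa using inv_mul_cancel₀ (sub_ne_zero.2 (Ne.symm hj))
  choose g hg using H
  refine ⟨∏ k ∈ Finset.univ.erase l, g k, fun k => ?_⟩
  rw [map_prod]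
  split_ifs with hk
  · subst hk
    exact Finset.prod_eq_one fun j hj => (hg j (Finset.ne_of_mem_erase hj)).2
  · exact Finset.prod_eq_zero (Finset.mem_erase.2 ⟨hk, Finset.mem_univ k⟩) (hg k hk).1

end Independence

section Count

variable {n : ℕ}

/-- Exponents of total degree at most `k`. -/
def exponentsOfDegreeLE (n k : ℕ) : Finset (Fin n →₀ ℕ) :=
  (Finset.range (k + 1)).biUnion fun j => Finset.univ.finsuppAntidiag j

theorem degree_le_of_mem_exponentsOfDegreeLE {k : ℕ} {e : Fin n →₀ ℕ}
    (he : e ∈ exponentsOfDegreeLE n k) : ∑ i, e i ≤ k := by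
  simp only [exponentsOfDegreeLE, Finset.mem_biUnion, Finset.mem_range,
    Finset.mem_finsuppAntidiag] at he
  obtain ⟨j, hj, h, -⟩ := he
  exact le_of_eq_of_le h (by omega)

theorem pow_le_factorial_mul_card_exponentsOfDegreeLE (hn : 1 ≤ n) (k : ℕ) :
    k ^ n ≤ n.factorial * (exponentsOfDegreeLE n k).card := by
  obtain ⟨n, rfl⟩ := Nat.exists_eq_add_of_le' hn
  rw [exponentsOfDegreeLE, Finset.card_biUnion]
  · simp only [Finset.card_finsuppAntidiag_nat_eq_choose, Finset.card_univ, Fintype.card_fin]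
    have h : ∀ j ∈ Finset.range (k + 1), (n + 1 + j - 1).choose j = (j + n).choose n := by
      intro j _
      rw [show n + 1 + j - 1 = j + n by omega, Nat.choose_symm_add]
    rw [Finset.sum_congr rfl h, Nat.sum_range_add_choose, ← Nat.descFactorial_eq_factorial_mul_choose]
    refine le_trans (Nat.pow_le_pow_left ?_ _) (Nat.pow_sub_le_descFactorial _ _)
    omega
  · intro i _ j _ hij
    refine Finset.disjoint_left.2 ?_
    intro e hi hj
    rw [Finset.mem_finsuppAntidiag] at hi hj
    exact hij (hi.1.symm.trans hj.1)

theorem card_mul_card_le_ncard_dilateExponents {Q : Set (Fin n → ℝ)} (hQ : Convex ℝ Q)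
    (h0 : (0 : Fin n → ℝ) ∈ Q) (hb : Bornology.IsBounded Q)
    {ι : Type*} [Fintype ι] [DecidableEq ι] {z : ι → Fin n → ℝ} {M c k : ℕ}
    {h : Fin n → MvPolynomial (Fin n) ℝ} {g : ι → MvPolynomial (Fin n) ℝ}
    (hh : ∀ i, h i ∈ dilatePoly Q M) (hgc : ∀ l, g l ∈ dilatePoly Q c)
    (hz : ∀ k (i : Fin n), eval (z k) (h i) = 0)
    (hdet : ∀ k, (Matrix.of fun i j => eval (z k) (pderiv j (h i))).det ≠ 0)
    (hg : ∀ k l, eval (z k) (g l) = if k = l then 1 else 0) (hpos : 0 < k * M + c) :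
    (exponentsOfDegreeLE n k).card * Fintype.card ι ≤ (dilateExponents Q (k * M + c)).ncard := by
  have hli := (linearIndependent_of_simple_zeros z h g hz hdet hg).comp
    (fun a : exponentsOfDegreeLE n k × ι => ((a.1 : Fin n →₀ ℕ), a.2))
    (fun a b hab => by
      simp only [Prod.mk.injEq] at hab
      exact Prod.ext (Subtype.ext hab.1) hab.2)
  have hmem : ∀ a : exponentsOfDegreeLE n k × ι,
      (∏ i, h i ^ (a.1 : Fin n →₀ ℕ) i) * g a.2 ∈ dilatePoly Q (k * M + c) := by
    intro a
    refine dilatePoly_mul_mem hQ (dilatePoly_mono hQ h0 ?_ (dilatePoly_prod_mem hQ h0 _ _ _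
      fun i _ => dilatePoly_pow_mem hQ h0 (hh i) _)) (hgc _)
    rw [← Finset.sum_mul]
    exact Nat.mul_le_mul_right _ (degree_le_of_mem_exponentsOfDegreeLE a.1.2)
  have := finiteDimensional_dilatePoly hb hpos
  have hli' : LinearIndependent ℝ (fun a : exponentsOfDegreeLE n k × ι =>
      (⟨_, hmem a⟩ : dilatePoly Q (k * M + c))) :=
    LinearIndependent.of_comp (Submodule.subtype _) hli
  simpa [finrank_dilatePoly] using hli'.fintype_card_le_finrank

open MeasureTheory in
/-- **Kushnirenko's bound** for simple real zeros of a square polynomial system. -/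
theorem card_simple_zeros_le (hn : 1 ≤ n) {Q : Set (Fin n → ℝ)} (hQ : Convex ℝ Q)
    (h0 : (0 : Fin n → ℝ) ∈ Q) (he : ∀ j, Pi.single j (1 : ℝ) ∈ Q) (hc : IsCompact Q)
    {ι : Type*} [Fintype ι] {z : ι → Fin n → ℝ} (hinj : Function.Injective z) {M : ℕ} (hM : 0 < M)
    {h : Fin n → MvPolynomial (Fin n) ℝ} (hh : ∀ i, h i ∈ dilatePoly Q M)
    (hz : ∀ k (i : Fin n), eval (z k) (h i) = 0)
    (hdet : ∀ k, (Matrix.of fun i j => eval (z k) (pderiv j (h i))).det ≠ 0) :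
    (Fintype.card ι : ℝ) ≤ M ^ n * (n.factorial * (volume Q).toReal) := by
  classical
  choose g hg using fun l => exists_interpolation hinj l
  choose c hc' using fun l => exists_mem_dilatePoly hQ h0 he (g l)
  let K := ∑ l, c l
  have hgK : ∀ l, g l ∈ dilatePoly Q K := fun l =>
    dilatePoly_mono hQ h0 (Finset.single_le_sum (f := c) (by simp) (Finset.mem_univ l)) (hc' l)
  have hM' : (M : ℝ) ≠ 0 := by positivity
  have hb := hc.isBounded
  have hvol := tendsto_card_div_pow_atTop_volume Q hb hc.measurableSet (hQ.addHaar_frontier volume)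
  rw [Fintype.card_fin] at hvol
  have hm : Tendsto (fun k : ℕ => k * M + K) atTop atTop :=
    tendsto_atTop_mono (fun k => le_trans (Nat.le_mul_of_pos_right k hM) (Nat.le_add_right _ _))
      tendsto_id
  have hR := (hvol.comp hm).const_mul (n.factorial : ℝ)
  have hL : Tendsto (fun k : ℕ => (Fintype.card ι : ℝ) * ((k : ℝ) / ((k * M + K : ℕ) : ℝ)) ^ n)
      atTop (𝓝 (Fintype.card ι * (1 / (M : ℝ)) ^ n)) := by
    refine (Tendsto.pow ?_ n).const_mul _
    have h1 : Tendsto (fun k : ℕ => 1 / ((M : ℝ) + K / k)) atTop (𝓝 (1 / (M + 0))) :=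
      tendsto_const_nhds.div
        (tendsto_const_nhds.add (tendsto_const_div_atTop_nhds_zero_nat (K : ℝ))) (by simpa using hM.ne')
    rw [add_zero] at h1
    refine h1.congr' ?_
    filter_upwards [eventually_gt_atTop 0] with k hk
    have : (k : ℝ) ≠ 0 := by positivity
    push_cast
    field_simp
  have hle := le_of_tendsto_of_tendsto hL hR ?_
  · rw [one_div, inv_pow, ← div_eq_mul_inv, div_le_iff₀ (by positivity)] at hle
    simpa [Measure.real, mul_comm, mul_left_comm] using hle
  · filter_upwards [eventually_gt_atTop 0] with k hk
    have hpos : 0 < k * M + K := by positivity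
    have hcard := card_mul_card_le_ncard_dilateExponents hQ h0 hb hh hgK hz hdet
      (fun k l => hg l k) hpos
    have hcard' := hcard.trans (ncard_dilateExponents_le hb hpos)
    have hpow := pow_le_factorial_mul_card_exponentsOfDegreeLE hn k
    simp only [Function.comp_apply]
    rw [div_pow, mul_div_assoc', mul_div_assoc']
    refine div_le_div_of_nonneg_right ?_ (by positivity)
    calc (Fintype.card ι : ℝ) * (k : ℝ) ^ n
        ≤ Fintype.card ι * (n.factorial * (exponentsOfDegreeLE n k).card) := by
          gcongr; exact_mod_cast hpow
      _ = n.factorial * ((exponentsOfDegreeLE n k).card * Fintype.card ι) := by ring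
      _ ≤ _ := by gcongr; exact_mod_cast hcard'

end Count

section Critical

variable {n : ℕ}

open MeasureTheory

theorem MvPolynomial.ae_gradient_regular (P : MvPolynomial (Fin n) ℝ) :
    ∀ᵐ a : Fin n → ℝ, ∀ x : Fin n → ℝ, (∀ i, eval x (pderiv i P) = a i) →
      (∀ i, x i ≠ 0) ∧ (Matrix.of fun i j => eval x (pderiv j (pderiv i P))).det ≠ 0 := by
  let G : (Fin n → ℝ) → (Fin n → ℝ) := fun x i => eval x (pderiv i P)
  let H : (Fin n → ℝ) → Matrix (Fin n) (Fin n) ℝ :=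
    fun x => Matrix.of fun i j => eval x (pderiv j (pderiv i P))
  have hG : ∀ x, HasFDerivAt G (LinearMap.toContinuousLinearMap (Matrix.toLin' (H x))) x := by
    intro x
    rw [hasFDerivAt_pi']
    intro i
    refine (hasFDerivAt_eval (pderiv i P) x).congr_fderiv ?_
    ext v
    simp [H, Matrix.mulVec, dotProduct]
  have h1 : volume (G '' {x | (H x).det = 0}) = 0 := by
    refine addHaar_image_eq_zero_of_det_fderivWithin_eq_zero volume
      (fun x _ => (hG x).hasFDerivWithinAt) fun x hx => ?_
    simpa [ContinuousLinearMap.det] using hx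
  have h2 : ∀ i, volume (G '' {x | x i = 0}) = 0 := by
    intro i
    refine addHaar_image_eq_zero_of_differentiableOn_of_addHaar_eq_zero volume
      (fun x _ => (hG x).differentiableAt.differentiableWithinAt) ?_
    have := Measure.addHaar_submodule (volume : Measure (Fin n → ℝ))
      (LinearMap.ker (LinearMap.proj i : (Fin n → ℝ) →ₗ[ℝ] ℝ)) (fun htop => by
        have : (Pi.single i 1 : Fin n → ℝ) ∈
            LinearMap.ker (LinearMap.proj i : (Fin n → ℝ) →ₗ[ℝ] ℝ) := by
          rw [htop]; trivial
        simp at this)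
    exact this
  have h3 := measure_iUnion_null h2
  filter_upwards [compl_mem_ae_iff.2 h1, compl_mem_ae_iff.2 h3] with a ha1 ha2 x hx
  have hGx : G x = a := _root_.funext hx
  exact ⟨fun i hi => ha2 (mem_iUnion.2 ⟨i, x, hi, hGx⟩), fun hd => ha1 ⟨x, hd, hGx⟩⟩

theorem card_isolating_regions_le (hn : 1 ≤ n) {Q : Set (Fin n → ℝ)} (hQ : Convex ℝ Q)
    (h0 : (0 : Fin n → ℝ) ∈ Q) (he : ∀ j, Pi.single j (1 : ℝ) ∈ Q) (hc : IsCompact Q)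
    {M : ℕ} (hM : 0 < M) {P : MvPolynomial (Fin n) ℝ} (hP : P ∈ dilatePoly Q M)
    {ι : Type*} [Fintype ι] {O : ι → Set (Fin n → ℝ)} {z : ι → Fin n → ℝ}
    (hopen : ∀ k, IsOpen (O k)) (hbdd : ∀ k, Bornology.IsBounded (O k))
    (hdisj : Pairwise fun k l => Disjoint (O k) (O l)) (hz : ∀ k, z k ∈ O k)
    (hpos : ∀ k, 0 < eval (z k) P) (hneg : ∀ k, ∀ x ∈ frontier (O k), eval x P ≤ 0) :
    (Fintype.card ι : ℝ) ≤ M ^ n * (n.factorial * (volume Q).toReal) := by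
  have hcomp : ∀ k, IsCompact (closure (O k)) := fun k => (hbdd k).isCompact_closure
  have hsmall : ∀ᶠ a : Fin n → ℝ in 𝓝 0, ∀ k, ∀ x ∈ closure (O k),
      |∑ i, a i * x i| < eval (z k) P / 2 := by
    rw [eventually_all]
    intro k
    refine (hcomp k).eventually_forall_of_forall_eventually fun x _ => ?_
    have hcont : Continuous fun q : (Fin n → ℝ) × (Fin n → ℝ) => |∑ i, q.1 i * q.2 i| := by
      fun_prop
    exact (hcont.tendsto (0, x)).eventually_lt_const (by simpa using hpos k)
  obtain ⟨a, hreg, ha⟩ :=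
    (Measure.dense_of_ae (ae_gradient_regular P)).inter_nhds_nonempty hsmall
  have hcrit : ∀ k, ∃ x ∈ O k, ∀ i, eval x (pderiv i P) = a i := by
    intro k
    let P' : MvPolynomial (Fin n) ℝ := P - ∑ i, C (a i) * X i
    have hP' : ∀ x, eval x P' = eval x P - ∑ i, a i * x i := fun x => by simp [P']
    obtain ⟨x, hx, hmax⟩ := (hcomp k).exists_isMaxOn ⟨z k, subset_closure (hz k)⟩
      (MvPolynomial.continuous_eval P').continuousOn
    have hxO : x ∈ O k := by
      rw [← (hopen k).interior_eq, ← closure_sdiff_frontier]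
      refine ⟨hx, fun hf => ?_⟩
      have h1 : eval (z k) P' ≤ eval x P' := hmax (subset_closure (hz k))
      rw [hP', hP'] at h1
      have h2 := abs_lt.1 (ha k x hx)
      have h3 := abs_lt.1 (ha k (z k) (subset_closure (hz k)))
      have h4 := hneg k x hf
      linarith [h2.1, h3.2]
    refine ⟨x, hxO, fun i => ?_⟩
    have hloc : IsLocalMax (fun x => eval x P') x :=
      (hmax.on_subset subset_closure).isLocalMax ((hopen k).mem_nhds hxO)
    have hfd := congrArg (fun L => L (Pi.single i 1))
      (hloc.hasFDerivAt_eq_zero (hasFDerivAt_eval P' x))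
    simp [P', Pi.single_apply] at hfd
    linarith
  choose x hxO hx using hcrit
  have hinj : Function.Injective x := by
    intro k l hkl
    by_contra hne
    exact Set.disjoint_left.1 (hdisj hne) (hxO k) (hkl ▸ hxO l)
  refine card_simple_zeros_le hn hQ h0 he hc hinj hM
    (h := fun i => X i * (pderiv i P - C (a i))) ?_ ?_ ?_
  · intro i
    rw [mul_sub, mul_comm (X i) (C _), ← smul_eq_C_mul]
    exact sub_mem (X_mul_pderiv_mem_restrictSupport hP i) (Submodule.smul_mem _ _
      (dilatePoly_mono hQ h0 hM (dilatePoly_X_mem he i)))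
  · intro k i
    simp [hx]
  · intro k
    obtain ⟨hne, hdet⟩ := hreg (x k) (hx k)
    have : (Matrix.of fun i j => eval (x k) (pderiv j (X i * (pderiv i P - C (a i))))) =
        Matrix.diagonal (x k) * Matrix.of fun i j => eval (x k) (pderiv j (pderiv i P)) := by
      ext i j
      simp [Matrix.diagonal_mul, hx]
    rw [this, Matrix.det_mul, Matrix.det_diagonal]
    exact mul_ne_zero (Finset.prod_ne_zero_iff.2 fun i _ => hne i) hdet

end Critical

section Separation

theorem exists_separating_opens {X : Type*} [MetricSpace X] {ι : Type*} [Finite ι] {S T : Set X}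
    (hT : IsCompact T) (hTS : T ⊆ S) (z : ι → S) (hzT : ∀ k, (z k : X) ∈ T)
    (hinj : Function.Injective fun k => (z k : ConnectedComponents S)) :
    ∃ U : ι → Set X, (∀ k, IsOpen (U k)) ∧ (Pairwise fun k l => Disjoint (U k) (U l)) ∧
      (∀ k, (z k : X) ∈ U k) ∧ ∀ k, Disjoint (frontier (U k)) T := by
  have : CompactSpace T := isCompact_iff_compactSpace.1 hT
  let w : ι → T := fun k => ⟨z k, hzT k⟩
  have hA : ∀ k l, ∃ A : Set T, IsClopen A ∧ w k ∈ A ∧ (k ≠ l → w l ∉ A) := by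
    intro k l
    by_cases hkl : k = l
    · exact ⟨univ, isClopen_univ, mem_univ _, fun h => (h hkl).elim⟩
    have hnot : w l ∉ connectedComponent (w k) := by
      intro hmem
      have := (continuous_inclusion hTS).image_connectedComponent_subset (w k) ⟨_, hmem, rfl⟩
      exact hkl (hinj (ConnectedComponents.coe_eq_coe'.2 this)).symm
    rw [connectedComponent_eq_iInter_isClopen, mem_iInter, not_forall] at hnot
    obtain ⟨⟨A, hA, hk⟩, hl⟩ := hnot
    exact ⟨A, hA, hk, fun _ => hl⟩
  choose A hAc hAk hAl using hA
  let V : ι → Set T := fun k => ⋂ l, {t | k ≠ l → t ∈ A k l ∧ t ∉ A l k}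
  have hV : ∀ k, IsClopen (V k) := by
    intro k
    refine isClopen_iInter_of_finite fun l => ?_
    by_cases hkl : k = l
    · simp [hkl, isClopen_univ]
    · have hset : {t | k ≠ l → t ∈ A k l ∧ t ∉ A l k} = A k l ∩ (A l k)ᶜ := by
        ext; simp [hkl]
      rw [hset]
      exact (hAc k l).inter (hAc l k).compl
  have hwV : ∀ k, w k ∈ V k := fun k =>
    mem_iInter.2 fun l hkl => ⟨hAk k l, hAl l k (Ne.symm hkl)⟩
  have hVV : ∀ k l, k ≠ l → V l ⊆ (V k)ᶜ := fun k l hkl t htl htk =>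
    ((mem_iInter.1 htl k) (Ne.symm hkl)).2 ((mem_iInter.1 htk l) hkl).1
  let W : ι → Set X := fun k => Subtype.val '' V k
  let W' : ι → Set X := fun k => Subtype.val '' (V k)ᶜ
  have hW : ∀ k, IsClosed (W k) := fun k =>
    ((hV k).isClosed.isCompact.image continuous_subtype_val).isClosed
  have hW' : ∀ k, IsClosed (W' k) := fun k =>
    ((hV k).compl.isClosed.isCompact.image continuous_subtype_val).isClosed
  have hWW' : ∀ k, Disjoint (W k) (W' k) := fun k =>
    (disjoint_image_iff Subtype.val_injective).2 disjoint_compl_right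
  have hanti : ∀ k l, k ≠ l → ∀ x, Metric.infEDist x (W' k) ≤ Metric.infEDist x (W l) :=
    fun k l hkl x => Metric.infEDist_anti (image_mono (hVV k l hkl))
  refine ⟨fun k => {x | Metric.infEDist x (W k) < Metric.infEDist x (W' k)}, fun k =>
    isOpen_lt Metric.continuous_infEDist Metric.continuous_infEDist, ?_, ?_, ?_⟩
  · intro k l hkl
    refine Set.disjoint_left.2 fun x hk hl => ?_
    exact lt_irrefl _ ((hk.trans_le (hanti k l hkl x)).trans (hl.trans_le (hanti l k hkl.symm x)))
  · intro k
    have hk : (z k : X) ∈ W k := ⟨w k, hwV k, rfl⟩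
    change Metric.infEDist _ _ < Metric.infEDist _ _
    rw [Metric.infEDist_zero_of_mem hk, pos_iff_ne_zero]
    intro h
    exact Set.disjoint_left.1 (hWW' k) hk ((Metric.mem_iff_infEDist_zero_of_closed (hW' k)).2 h)
  · intro k
    refine Set.disjoint_left.2 fun x hx hxT => ?_
    have heq : Metric.infEDist x (W k) = Metric.infEDist x (W' k) :=
      frontier_lt_subset_eq Metric.continuous_infEDist Metric.continuous_infEDist hx
    by_cases hxV : (⟨x, hxT⟩ : T) ∈ V k
    · have hk : x ∈ W k := ⟨_, hxV, rfl⟩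
      rw [Metric.infEDist_zero_of_mem hk] at heq
      exact Set.disjoint_left.1 (hWW' k) hk ((Metric.mem_iff_infEDist_zero_of_closed (hW' k)).2 heq.symm)
    · have hk : x ∈ W' k := ⟨_, hxV, rfl⟩
      rw [Metric.infEDist_zero_of_mem hk] at heq
      exact Set.disjoint_left.1 (hWW' k) ((Metric.mem_iff_infEDist_zero_of_closed (hW k)).2 heq) hk

end Separation

section Components

variable {n : ℕ}

theorem abs_eval_le_sum_coeff_mul {A : Finset (Fin n →₀ ℕ)} {p : MvPolynomial (Fin n) ℝ}
    (hp : p.support ⊆ A) (x : Fin n → ℝ) :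
    |eval x p| ≤ (∑ v ∈ A, |coeff v p|) * ∑ v ∈ A, |∏ i, x i ^ v i| := by
  rw [eval_eq', Finset.sum_subset hp (fun v _ hv => by simp [notMem_support_iff.1 hv])]
  refine (Finset.abs_sum_le_sum_abs _ _).trans ?_
  rw [Finset.mul_sum]
  refine Finset.sum_le_sum fun v hv => ?_
  rw [abs_mul]
  exact mul_le_mul_of_nonneg_right
    (Finset.single_le_sum (f := fun v => |coeff v p|) (fun _ _ => abs_nonneg _) hv) (abs_nonneg _)

theorem exists_sq_eval_prod_le {A : Finset (Fin n →₀ ℕ)} {β : Type*} [Fintype β] [Nonempty β]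
    {g : β → MvPolynomial (Fin n) ℝ} (hg : ∀ j, (g j).support ⊆ A) :
    ∃ B : ℝ, ∀ x : Fin n → ℝ, (eval x (∏ j, g j)) ^ 2 ≤
      B * ∑ v ∈ A, (∏ i, x i ^ v i) ^ (2 * Fintype.card β) := by
  obtain ⟨m, hm⟩ := Nat.exists_eq_add_of_le' (Nat.mul_pos two_pos (Fintype.card_pos (α := β)))
  refine ⟨(∏ j, ∑ v ∈ A, |coeff v (g j)|) ^ 2 * (A.card : ℝ) ^ m, fun x => ?_⟩
  have h1 : |eval x (∏ j, g j)| ≤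
      (∏ j, ∑ v ∈ A, |coeff v (g j)|) * (∑ v ∈ A, |∏ i, x i ^ v i|) ^ Fintype.card β := by
    rw [map_prod, Finset.abs_prod]
    refine (Finset.prod_le_prod (fun _ _ => abs_nonneg _)
      fun j _ => abs_eval_le_sum_coeff_mul (hg j) x).trans_eq ?_
    rw [Finset.prod_mul_distrib, Finset.prod_const, Finset.card_univ]
  have h2 : (∑ v ∈ A, |∏ i, x i ^ v i|) ^ (2 * Fintype.card β) ≤
      (A.card : ℝ) ^ m * ∑ v ∈ A, (∏ i, x i ^ v i) ^ (2 * Fintype.card β) := by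
    have := pow_sum_le_card_mul_sum_pow (s := A) (f := fun v => |∏ i, x i ^ v i|)
      (fun _ _ => abs_nonneg _) m
    rw [← hm] at this
    simpa only [(even_two_mul (Fintype.card β)).pow_abs] using this
  calc (eval x (∏ j, g j)) ^ 2 = |eval x (∏ j, g j)| ^ 2 := (sq_abs _).symm
    _ ≤ ((∏ j, ∑ v ∈ A, |coeff v (g j)|) *
          (∑ v ∈ A, |∏ i, x i ^ v i|) ^ Fintype.card β) ^ 2 := by gcongr
    _ = (∏ j, ∑ v ∈ A, |coeff v (g j)|) ^ 2 *
          (∑ v ∈ A, |∏ i, x i ^ v i|) ^ (2 * Fintype.card β) := by ring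
    _ ≤ _ := by
      rw [mul_assoc]
      gcongr

open MeasureTheory in
theorem card_le_of_injective_connectedComponents (hn : 1 ≤ n) {Q : Set (Fin n → ℝ)}
    (hQ : Convex ℝ Q) (h0 : (0 : Fin n → ℝ) ∈ Q) (he : ∀ j, Pi.single j (1 : ℝ) ∈ Q)
    (hc : IsCompact Q) {A : Finset (Fin n →₀ ℕ)} (hAQ : (A : Set (Fin n →₀ ℕ)) ⊆ dilateExponents Q 1)
    (hA0 : 0 ∈ A) (hA1 : ∀ j, Finsupp.single j 1 ∈ A)
    {α β : Type*} [Fintype α] [Fintype β] [Nonempty β]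
    {f : α → MvPolynomial (Fin n) ℝ} {g : β → MvPolynomial (Fin n) ℝ}
    (hf : ∀ i, (f i).support ⊆ A) (hg : ∀ j, (g j).support ⊆ A) {S : Set (Fin n → ℝ)}
    (hS : S = {x | (∀ i, eval x (f i) = 0) ∧ ∀ j, 0 < eval x (g j)})
    {ι : Type*} [Fintype ι] (z : ι → S)
    (hinj : Function.Injective fun k => (z k : ConnectedComponents S)) :
    (Fintype.card ι : ℝ) ≤
      ((2 * Fintype.card β : ℕ) : ℝ) ^ n * (n.factorial * (volume Q).toReal) := by
  have hβ : 0 < Fintype.card β := Fintype.card_pos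
  have hzS : ∀ k, (∀ i, eval (z k : Fin n → ℝ) (f i) = 0) ∧
      ∀ j, 0 < eval (z k : Fin n → ℝ) (g j) := fun k => hS.subset (z k).2
  let G : MvPolynomial (Fin n) ℝ := ∏ j, g j
  let F : MvPolynomial (Fin n) ℝ := ∑ i, f i ^ 2
  let R : MvPolynomial (Fin n) ℝ := ∑ v ∈ A, monomial v 1 ^ (2 * Fintype.card β)
  have hR : ∀ x, eval x R = ∑ v ∈ A, (∏ i, x i ^ v i) ^ (2 * Fintype.card β) := by
    intro x
    simp only [R, map_sum, map_pow, eval_monomial, one_mul]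
    exact Finset.sum_congr rfl fun v _ => by rw [Finsupp.prod_fintype _ _ (by simp)]
  have hterm : ∀ x : Fin n → ℝ, ∀ v ∈ A, (∏ i, x i ^ v i) ^ (2 * Fintype.card β) ≤ eval x R := by
    intro x v hv
    rw [hR]
    exact Finset.single_le_sum (f := fun v : Fin n →₀ ℕ => (∏ i, x i ^ v i) ^ (2 * Fintype.card β))
      (fun _ _ => (even_two_mul _).pow_nonneg _) hv
  have hR1 : ∀ x, 1 ≤ eval x R := fun x => by simpa using hterm x 0 hA0
  have hRx : ∀ x : Fin n → ℝ, ∀ j, x j ^ (2 * Fintype.card β) ≤ eval x R := by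
    intro x j
    have := hterm x _ (hA1 j)
    rwa [Finset.prod_eq_single j (fun i _ hij => by simp [hij.symm]) (by simp),
      Finsupp.single_eq_same, pow_one] at this
  have hmemA : ∀ {p : MvPolynomial (Fin n) ℝ}, p.support ⊆ A → p ∈ dilatePoly Q 1 := fun hp =>
    (mem_restrictSupport_iff ℝ).2 ((Finset.coe_subset.2 hp).trans hAQ)
  have hGmem : G ∈ dilatePoly Q (2 * Fintype.card β) := by
    refine dilatePoly_mono hQ h0 ?_ (dilatePoly_prod_mem hQ h0 Finset.univ (fun _ => 1) g
      fun j _ => hmemA (hg j))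
    simp
    omega
  have hFmem : F ∈ dilatePoly Q (2 * Fintype.card β) :=
    Submodule.sum_mem _ fun i _ => dilatePoly_mono hQ h0 (by omega)
      (dilatePoly_pow_mem hQ h0 (hmemA (hf i)) 2)
  have hRmem : R ∈ dilatePoly Q (2 * Fintype.card β) :=
    Submodule.sum_mem _ fun v hv => dilatePoly_mono hQ h0 (by omega) (dilatePoly_pow_mem hQ h0
      ((monomial_mem_restrictSupport ℝ).2 (Or.inl (hAQ hv))) (2 * Fintype.card β))
  have hFnonneg : ∀ x, 0 ≤ eval x F := fun x => by
    simp only [F, map_sum, map_pow]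
    positivity
  have hFzero : ∀ x, eval x F = 0 → ∀ i, eval x (f i) = 0 := by
    intro x hx i
    simp only [F, map_sum, map_pow] at hx
    simpa using (Finset.sum_eq_zero_iff_of_nonneg fun i _ => sq_nonneg _).1 hx i (Finset.mem_univ i)
  obtain ⟨η, hη, hη0⟩ : ∃ η : ℝ, (∀ k, η * eval (z k : Fin n → ℝ) R < eval (z k : Fin n → ℝ) G) ∧
      0 < η := by
    have hev : ∀ᶠ η : ℝ in 𝓝[>] 0,
        ∀ k, η * eval (z k : Fin n → ℝ) R < eval (z k : Fin n → ℝ) G := by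
      refine eventually_all.2 fun k => ?_
      have hcont : Continuous fun η : ℝ => η * eval (z k : Fin n → ℝ) R := by fun_prop
      refine ((hcont.tendsto 0).eventually_lt_const ?_).filter_mono nhdsWithin_le_nhds
      simp only [zero_mul, G, map_prod]
      exact Finset.prod_pos fun j _ => (hzS k).2 j
    exact (hev.and self_mem_nhdsWithin).exists
  have hcR := MvPolynomial.continuous_eval R
  have hcG := MvPolynomial.continuous_eval G
  have hcF := MvPolynomial.continuous_eval F
  let K : Set (Fin n → ℝ) := {x | η * eval x R ≤ eval x G ∧ ∀ j, 0 ≤ eval x (g j)}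
  have hKclosed : IsClosed K := by
    have hg' : IsClosed {x : Fin n → ℝ | ∀ j, 0 ≤ eval x (g j)} := by
      rw [ofPred_forall]
      exact isClosed_iInter fun j => isClosed_le continuous_const (MvPolynomial.continuous_eval _)
    exact (isClosed_le (by fun_prop) hcG).inter hg'
  have hKbdd : Bornology.IsBounded K := by
    obtain ⟨B, hB⟩ := exists_sq_eval_prod_le hg
    refine (Metric.isBounded_closedBall (x := 0) (r := max 1 (B / η ^ 2))).subset fun x hx => ?_
    have hxR : eval x R ≤ B / η ^ 2 := by
      rw [le_div_iff₀ (by positivity)]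
      have h1 := hR1 x
      have h2 : (η * eval x R) ^ 2 ≤ B * eval x R := by
        refine le_trans ?_ ((hB x).trans_eq (by rw [hR]))
        have := hx.1
        gcongr
      have h3 : eval x R * (eval x R * η ^ 2) ≤ eval x R * B := by nlinarith
      exact le_of_mul_le_mul_left h3 (by linarith)
    rw [mem_closedBall_zero_iff, pi_norm_le_iff_of_nonneg (by positivity)]
    intro j
    rw [Real.norm_eq_abs]
    by_cases hj : |x j| ≤ 1
    · exact hj.trans (le_max_left _ _)
    · refine le_trans ?_ ((hRx x j).trans (hxR.trans (le_max_right _ _)))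
      rw [← (even_two_mul _).pow_abs]
      exact le_self_pow₀ (not_le.1 hj).le (by omega)
  have hKpos : ∀ x ∈ K, ∀ j, 0 < eval x (g j) := by
    intro x hx j
    have hGpos : 0 < eval x G := lt_of_lt_of_le (mul_pos hη0 (by linarith [hR1 x])) hx.1
    simp only [G, map_prod] at hGpos
    exact lt_of_le_of_ne (hx.2 j) (Finset.prod_ne_zero_iff.1 hGpos.ne' j (Finset.mem_univ j)).symm
  have hKcomp : IsCompact K := Metric.isCompact_of_isClosed_isBounded hKclosed hKbdd
  let T : Set (Fin n → ℝ) := K ∩ {x | eval x F = 0}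
  have hT : IsCompact T := hKcomp.inter_right (isClosed_eq hcF continuous_const)
  have hTS : T ⊆ S := fun x hx => by
    rw [hS]
    exact ⟨hFzero x hx.2, hKpos x hx.1⟩
  have hzT : ∀ k, (z k : Fin n → ℝ) ∈ T := fun k =>
    ⟨⟨(hη k).le, fun j => ((hzS k).2 j).le⟩, by simp [F, (hzS k).1]⟩
  obtain ⟨U, hUo, hUd, hzU, hUT⟩ := exists_separating_opens hT hTS z hzT hinj
  obtain ⟨ε, hε, hε0⟩ : ∃ ε : ℝ, (∀ k, ∀ x ∈ K ∩ frontier (U k),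
      ε * (eval x G - η * eval x R) - eval x F < 0) ∧ 0 < ε := by
    have hev : ∀ᶠ ε : ℝ in 𝓝 0, ∀ k, ∀ x ∈ K ∩ frontier (U k),
        ε * (eval x G - η * eval x R) - eval x F < 0 := by
      refine eventually_all.2 fun k =>
        (hKcomp.inter_right isClosed_frontier).eventually_forall_of_forall_eventually fun x hx => ?_
      have hcont : Continuous fun q : ℝ × (Fin n → ℝ) =>
          q.1 * (eval q.2 G - η * eval q.2 R) - eval q.2 F :=
        (continuous_fst.mul ((hcG.comp continuous_snd).sub
          (continuous_const.mul (hcR.comp continuous_snd)))).sub (hcF.comp continuous_snd)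
      refine (hcont.tendsto (0, x)).eventually_lt_const ?_
      have hne : eval x F ≠ 0 := fun h => Set.disjoint_left.1 (hUT k) hx.2 ⟨hx.1, h⟩
      simpa using lt_of_le_of_ne (hFnonneg x) hne.symm
    exact ((hev.filter_mono nhdsWithin_le_nhds).and (self_mem_nhdsWithin (s := Ioi 0))).exists
  let P : MvPolynomial (Fin n) ℝ := C ε * (G - C η * R) - F
  have hPeval : ∀ x, eval x P = ε * (eval x G - η * eval x R) - eval x F := fun x => by simp [P]
  have hPmem : P ∈ dilatePoly Q (2 * Fintype.card β) := by
    simp only [P, ← smul_eq_C_mul]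
    exact sub_mem (Submodule.smul_mem _ _ (sub_mem hGmem (Submodule.smul_mem _ _ hRmem))) hFmem
  let Ω : Set (Fin n → ℝ) := {x | η * eval x R < eval x G ∧ ∀ j, 0 < eval x (g j)}
  have hΩo : IsOpen Ω := by
    have hg' : IsOpen {x : Fin n → ℝ | ∀ j, 0 < eval x (g j)} := by
      rw [ofPred_forall]
      exact isOpen_iInter_of_finite fun j =>
        isOpen_lt continuous_const (MvPolynomial.continuous_eval _)
    exact (isOpen_lt (by fun_prop) hcG).inter hg'
  have hΩK : Ω ⊆ K := fun x hx => ⟨hx.1.le, fun j => (hx.2 j).le⟩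
  refine card_isolating_regions_le hn hQ h0 he hc (by omega) hPmem
    (O := fun k => U k ∩ Ω) (z := fun k => (z k : Fin n → ℝ)) (fun k => (hUo k).inter hΩo)
    (fun k => hKbdd.subset (inter_subset_right.trans hΩK))
    (fun k l hkl => (hUd hkl).mono inter_subset_left inter_subset_left)
    (fun k => ⟨hzU k, hη k, (hzS k).2⟩) ?_ ?_
  · intro k
    rw [hPeval, show eval (z k : Fin n → ℝ) F = 0 from (hzT k).2, sub_zero]
    exact mul_pos hε0 (sub_pos.2 (hη k))
  · intro k x hx
    rw [((hUo k).inter hΩo).frontier_eq] at hx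
    have hxK : x ∈ K := closure_minimal (inter_subset_right.trans hΩK) hKclosed hx.1
    rw [hPeval]
    by_cases hxΩ : x ∈ Ω
    · refine (hε k x ⟨hxK, ?_⟩).le
      rw [(hUo k).frontier_eq]
      exact ⟨closure_mono inter_subset_left hx.1, fun hxU => hx.2 ⟨hxU, hxΩ⟩⟩
    · have hle : eval x G ≤ η * eval x R := not_lt.1 fun h => hxΩ ⟨h, hKpos x hxK⟩
      nlinarith [hFnonneg x]

end Components

theorem Finite.and_natCard_le_of_forall_fin {α : Type*} {B : ℝ}
    (h : ∀ (N : ℕ) (u : Fin N → α), Function.Injective u → (N : ℝ) ≤ B) :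
    Finite α ∧ (Nat.card α : ℝ) ≤ B := by
  have hfin : Finite α := by
    by_contra hinf
    rw [not_finite_iff_infinite] at hinf
    obtain ⟨N, hN⟩ := exists_nat_gt B
    let u := (Infinite.natEmbedding α)
    exact absurd (h N (fun i => u i) (u.injective.comp Fin.val_injective)) (not_le.2 hN)
  exact ⟨hfin, h _ _ (Finite.equivFin α).symm.injective⟩

theorem stmt1 (n p s : ℕ) (hn : 1 ≤ n) (hs : 2 ≤ s)
    (f : Fin (p + s) → MvPolynomial (Fin n) ℝ)
    (S : Set (Fin n → ℝ))
    (hS : S = {x | (∀ i : Fin (p + s), (i : ℕ) < p → MvPolynomial.eval x (f i) = 0) ∧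
      (∀ i : Fin (p + s), p ≤ (i : ℕ) → 0 < MvPolynomial.eval x (f i))}) :
    Finite (ConnectedComponents ↥S) ∧
      (Nat.card (ConnectedComponents ↥S) : ℝ) ≤
        (((s : ℝ) + 1) / ((s : ℝ) - 1)) * (2 * s) ^ n * VF f := by
  classical
  refine Finite.and_natCard_le_of_forall_fin fun N u hu => ?_
  let A : Finset (Fin n →₀ ℕ) := insert 0 (Finset.univ.image (fun j => Finsupp.single j 1)) ∪
    Finset.univ.biUnion fun i => (f i).support
  have hgen : ({0} ∪ Set.range (fun j : Fin n => Pi.single j (1 : ℝ)) ∪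
      {x | ∃ i d, d ∈ (f i).support ∧ x = fun j => (d j : ℝ)}) =
      (fun d : Fin n →₀ ℕ => fun j => (d j : ℝ)) '' (A : Set (Fin n →₀ ℕ)) := by
    have hsingle : ∀ j : Fin n, (fun i => ((Finsupp.single j 1 : Fin n →₀ ℕ) i : ℝ)) =
        Pi.single j 1 := by
      intro j
      ext i
      by_cases h : i = j
      · subst h; simp
      · simp [h]
    ext x
    simp only [A, Finset.coe_union, Finset.coe_insert, Finset.coe_image, Finset.coe_biUnion,
      Finset.coe_univ, image_union, image_insert_eq, image_univ, ← range_comp]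
    simp only [mem_union, mem_insert_iff, mem_singleton_iff, mem_range, Function.comp_apply,
      hsingle, mem_image, mem_iUnion, mem_univ, Finset.mem_coe, mem_ofPred_eq]
    refine or_congr (or_congr ?_ Iff.rfl) ?_
    · simp [_root_.funext_iff]
    · constructor
      · rintro ⟨i, d, hd, rfl⟩
        exact ⟨d, ⟨i, trivial, hd⟩, rfl⟩
      · rintro ⟨d, ⟨i, -, hd⟩, rfl⟩
        exact ⟨i, d, hd, rfl⟩
  have hsub := subset_convexHull ℝ ({0} ∪ Set.range (fun j : Fin n => Pi.single j (1 : ℝ)) ∪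
      {x | ∃ i d, d ∈ (f i).support ∧ x = fun j => (d j : ℝ)})
  have hc : IsCompact (QF f) := by
    rw [QF, hgen]
    exact (A.finite_toSet.image _).isCompact_convexHull ℝ
  have hAQ : (A : Set (Fin n →₀ ℕ)) ⊆ dilateExponents (QF f) 1 := by
    intro d hd
    rw [dilateExponents, mem_ofPred_eq, Nat.cast_one, one_smul]
    exact hsub (hgen ▸ mem_image_of_mem _ hd)
  have hsupp : ∀ i, (f i).support ⊆ A := fun i =>
    (Finset.subset_biUnion_of_mem (fun i => (f i).support) (Finset.mem_univ i)).trans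
      Finset.subset_union_right
  have hcard : Fintype.card {i : Fin (p + s) // p ≤ (i : ℕ)} = s := by
    refine (Fintype.card_of_bijective (f := fun j : Fin s =>
      (⟨Fin.natAdd p j, by simp⟩ : {i : Fin (p + s) // p ≤ (i : ℕ)})) ⟨?_, ?_⟩).symm.trans
      (Fintype.card_fin s)
    · intro i j hij
      simpa using hij
    · rintro ⟨i, hi⟩
      exact ⟨⟨i - p, by omega⟩, Subtype.ext (Fin.ext (by simp; omega))⟩
  have : Nonempty {i : Fin (p + s) // p ≤ (i : ℕ)} := Fintype.card_pos_iff.1 (by omega)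
  choose z hz using fun k => ConnectedComponents.surjective_coe (u k)
  have key := card_le_of_injective_connectedComponents hn (convex_convexHull ℝ _)
    (hsub (by simp)) (fun j => hsub (by simp)) hc hAQ (by simp [A]) (fun j => by simp [A])
    (f := fun i : {i : Fin (p + s) // (i : ℕ) < p} => f i)
    (g := fun i : {i : Fin (p + s) // p ≤ (i : ℕ)} => f i)
    (fun i => hsupp i) (fun i => hsupp i) (S := S) (by simpa using hS) z
    (by simpa only [hz] using hu)
  rw [hcard, Fintype.card_fin] at key
  push_cast at key
  have hs' : (2 : ℝ) ≤ s := by exact_mod_cast hs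
  have hratio : 1 ≤ ((s : ℝ) + 1) / ((s : ℝ) - 1) := by
    rw [le_div_iff₀ (by linarith)]
    linarith
  rw [mul_assoc]
  refine key.trans (le_mul_of_one_le_left ?_ hratio)
  positivity
end
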